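/- Let v ∈ C_b(Ω,ℝ^d). Then for all p,q > 1 and all ω ∈ Ω* ∩ Ω_{p,q}, |Λ_r|^{-1} E_{Λ_r}^ω(v) converges, as r → ∞, to inf_{h∈C_b(Ω)} ⟨v − ∇h, c(v − ∇h)⟩_{L²(P_ω,ℝ^d)}. -/

import Mathlib

open MeasureTheory Filter Topology Matrix
open scoped ENNReal NNReal

noncomputable section

namespace DetCond

/-- Vertices of `ℤ^d`. -/
abbrev Vert (d : ℕ) := Fin d → ℤ

/-- Index of the (unordered) nearest-neighbour edge `(x, x + e i)` of `ℤ^d`;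
the set of these indices is in natural bijection with `E(ℤ^d)` modulo orientation. -/
abbrev EdgeIx (d : ℕ) := Vert d × Fin d

/-- The space `Ω = (0,∞)^{E(ℤ^d)}` of (symmetric) conductance configurations, with
its product topology and product σ-algebra. -/
abbrev EnvSp (d : ℕ) := {ω : EdgeIx d → ℝ // ∀ e, 0 < ω e}

/-- The `i`-th coordinate unit vector of `ℤ^d`. -/
def unitv (d : ℕ) (i : Fin d) : Vert d := fun j => if j = i then 1 else 0

/-- The translation `τ_x` acting on environments: `c_{τ_x ω}(y,z) = c_ω(y+x,z+x)`. -/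
def shift (d : ℕ) (x : Vert d) (ω : EnvSp d) : EnvSp d :=
  ⟨fun e => ω.1 (e.1 + x, e.2), fun e => ω.2 (e.1 + x, e.2)⟩

/-- The conductance `c_ω(x,y)`; it vanishes when `x,y` are not nearest neighbours
and is symmetric in `x,y` by construction. -/
def cnd (d : ℕ) (ω : EnvSp d) (x y : Vert d) : ℝ :=
  ∑ i, ((if y = x + unitv d i then ω.1 (x, i) else 0) +
        (if x = y + unitv d i then ω.1 (y, i) else 0))

/-- `π_ω(x) = Σ_{z : (x,z) ∈ E(ℤ^d)} c_ω(x,z)`. -/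
def piOf (d : ℕ) (ω : EnvSp d) (x : Vert d) : ℝ :=
  ∑ i, (ω.1 (x, i) + ω.1 (x - unitv d i, i))

/-- The box `Λ_r = [-r,r]^d ∩ ℤ^d`. -/
def box (d : ℕ) (r : ℝ) : Finset (Vert d) :=
  Fintype.piFinset fun _ : Fin d => Finset.Icc ⌈-r⌉ ⌊r⌋

/-- The nearest neighbours of `x` in `ℤ^d`. -/
def nbrs (d : ℕ) (x : Vert d) : Finset (Vert d) :=
  (Finset.univ.image fun i => x + unitv d i) ∪ (Finset.univ.image fun i => x - unitv d i)

/-- The set `E(Λ)` of edges incident with at least one vertex of `Λ`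
(one index per unordered edge). -/
def edgesIn (d : ℕ) (Λ : Finset (Vert d)) : Finset (EdgeIx d) :=
  Λ.biUnion fun x =>
    (Finset.univ.image fun i => (x, i)) ∪ (Finset.univ.image fun i => (x - unitv d i, i))

/-- Bounded functions on `Ω`. -/
def IsBdd (d : ℕ) (f : EnvSp d → ℝ) : Prop := ∃ M, ∀ ω, |f ω| ≤ M

/-- Local functions: `f` depends only on the coordinates in some finite set `B` of edges
and, viewed as a function of those coordinates, has compact support in `(0,∞)^B`. -/
def IsLocalFn (d : ℕ) (f : EnvSp d → ℝ) : Prop :=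
  ∃ B : Finset (EdgeIx d),
    (∀ ω₁ ω₂ : EnvSp d, (∀ e ∈ B, ω₁.1 e = ω₂.1 e) → f ω₁ = f ω₂) ∧
    ∃ a b : ℝ, 0 < a ∧ ∀ ω : EnvSp d, (∃ e ∈ B, ω.1 e < a ∨ b < ω.1 e) → f ω = 0

/-- `ℓ_ω(f) = L`, i.e. the block averages of the translates of `f` converge to `L`. -/
def avgTo (d : ℕ) (ω : EnvSp d) (f : EnvSp d → ℝ) (L : ℝ) : Prop :=
  Tendsto (fun n : ℕ => (∑ x ∈ box d (n : ℝ), f (shift d x ω)) / ((box d (n : ℝ)).card : ℝ))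
    atTop (𝓝 L)

/-- `ω` is averaging: `ℓ_ω(f)` exists for every continuous local `f`. -/
def Averaging (d : ℕ) (ω : EnvSp d) : Prop :=
  ∀ f : EnvSp d → ℝ, Continuous f → IsLocalFn d f → ∃ L, avgTo d ω f L

/-- `ω` is tempered, i.e. `ω ∈ Ω'`. -/
def Tempered (d : ℕ) (ω : EnvSp d) : Prop :=
  Tendsto (fun ε : ℝ =>
      limsup (fun n : ℕ =>
        (∑ e ∈ edgesIn d (box d (n : ℝ)),
            (if ε ≤ ω.1 e ∧ ω.1 e ≤ ε⁻¹ then (0:ℝ) else 1)) / (n : ℝ) ^ d) atTop)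
    (𝓝[>] 0) (𝓝 0)

/-- `P` is the measure `ℙ_ω` associated with an averaging tempered `ω`:
the unique probability measure whose expectation of every bounded continuous function
is the corresponding block-average limit `ℓ_ω(f)`. -/
def IsEnvLaw (d : ℕ) (ω : EnvSp d) (P : Measure (EnvSp d)) : Prop :=
  IsProbabilityMeasure P ∧
    ∀ f : EnvSp d → ℝ, Continuous f → IsBdd d f → avgTo d ω f (∫ ω', f ω' ∂P)

/-- Ergodicity of a measure on `Ω` with respect to the translations of `ℤ^d`. -/
def ErgodicEnv (d : ℕ) (P : Measure (EnvSp d)) : Prop :=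
  ∀ A : Set (EnvSp d), MeasurableSet A → (∀ x : Vert d, shift d x ⁻¹' A = A) →
    P A = 0 ∨ P A = 1

/-- `ω ∈ Ω⋆`: tempered, averaging, and the associated measure `ℙ_ω` is ergodic. -/
def InOmegaStar (d : ℕ) (ω : EnvSp d) : Prop :=
  Tempered d ω ∧ Averaging d ω ∧
    ∀ P : Measure (EnvSp d), IsEnvLaw d ω P → ErgodicEnv d P

/-- `ω ∈ Ω_{p,q}`. -/
def InOmegaPQ (d : ℕ) (p q : ℝ) (ω : EnvSp d) : Prop :=
  (∃ C : ℝ, ∀ n : ℕ, 1 ≤ n →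
      (∑ e ∈ edgesIn d (box d (n : ℝ)), ω.1 e ^ p) / (n : ℝ) ^ d ≤ C) ∧
  (∃ C : ℝ, ∀ n : ℕ, 1 ≤ n →
      (∑ e ∈ edgesIn d (box d (n : ℝ)), ω.1 e ^ (-q)) / (n : ℝ) ^ d ≤ C)

/-- The path space of the discrete-time walk. -/
abbrev Path (d : ℕ) := ℕ → Vert d

/-- One-step transition probabilities `𝖯_ω(x,y) = c_ω(x,y)/π_ω(x)`. -/
def transP (d : ℕ) (ω : EnvSp d) (x y : Vert d) : ℝ := cnd d ω x y / piOf d ω x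

/-- `μ` is the law `P_ω^{x₀}` of the random walk among the conductances `ω`
started at `x₀`: a probability measure on the path space with the prescribed
finite-dimensional (cylinder) probabilities. -/
def IsWalkLaw (d : ℕ) (ω : EnvSp d) (x₀ : Vert d) (μ : Measure (Path d)) : Prop :=
  IsProbabilityMeasure μ ∧
    ∀ (n : ℕ) (γ : ℕ → Vert d),
      μ {w | ∀ k ≤ n, w k = γ k} =
        (if γ 0 = x₀ then 1 else 0) *
          ∏ k ∈ Finset.range n, ENNReal.ofReal (transP d ω (γ k) (γ (k+1)))

/-- `n`-step transition probabilities of the discrete-time walk. -/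
def stepP (d : ℕ) (ω : EnvSp d) : ℕ → Vert d → Vert d → ℝ
  | 0, x, y => if x = y then 1 else 0
  | n+1, x, y => ∑ z ∈ nbrs d x, transP d ω x z * stepP d ω n z y

/-- `P_ω^x(Y_t = y)` for the constant-speed continuous-time walk `Y_t = X_{N(t)}`,
where `N` is an independent rate-1 Poisson process. -/
def ctP (d : ℕ) (ω : EnvSp d) (t : ℝ) (x y : Vert d) : ℝ :=
  ∑' k : ℕ, Real.exp (-t) * t ^ k / (Nat.factorial k : ℝ) * stepP d ω k x y

/-- The `ℓ¹`-norm of a vertex of `ℤ^d`. -/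
def l1 (d : ℕ) (x : Vert d) : ℝ := ∑ i, |(x i : ℝ)|

/-- A vertex of `ℤ^d` regarded as a point of `ℝ^d`. -/
def ivert (d : ℕ) (x : Vert d) : Fin d → ℝ := fun i => (x i : ℝ)

/-- The linearly interpolated diffusively rescaled walk `B^{(n)}`. -/
def BnProc (d : ℕ) (n : ℕ) (w : Path d) (t : ℝ) : Fin d → ℝ :=
  (Real.sqrt n)⁻¹ •
    (ivert d (w ⌊t * n⌋₊) +
      (t * n - (⌊t * n⌋₊ : ℝ)) • (ivert d (w (⌊t * n⌋₊ + 1)) - ivert d (w ⌊t * n⌋₊)))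


/-- The measure `ℚ_ω` obtained from `ℙ_ω` by tilting with `π(0)`. -/
def Qmeas (d : ℕ) (P : Measure (EnvSp d)) : Measure (EnvSp d) :=
  P.withDensity fun ω' => ENNReal.ofReal (piOf d ω' 0 / ∫ ω'', piOf d ω'' 0 ∂P)

/-- The inner product `⟨f,g⟩_{L²(πμ)}`. -/
def innerP (d : ℕ) (P : Measure (EnvSp d)) (f g : EnvSp d → ℝ) : ℝ :=
  ∫ ω', f ω' * g ω' * piOf d ω' 0 ∂P

/-- The Dirichlet pairing `⟨h, (−L)h⟩_{L²(πμ)}`. -/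
def quadL (d : ℕ) (P : Measure (EnvSp d)) (h : EnvSp d → ℝ) : ℝ :=
  ∫ ω', (∑ z ∈ nbrs d 0, cnd d ω' 0 z * (h ω' - h (shift d z ω'))) * h ω' ∂P

/-- The inner product of `L²(ν)`. -/
def innerQ (d : ℕ) (ν : Measure (EnvSp d)) (f g : EnvSp d → ℝ) : ℝ :=
  ∫ ω', f ω' * g ω' ∂ν

/-- The Dirichlet pairing `⟨h, (−L)h⟩_{L²(ν)}`. -/
def quadQ (d : ℕ) (ν : Measure (EnvSp d)) (h : EnvSp d → ℝ) : ℝ :=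
  ∫ ω', ((piOf d ω' 0)⁻¹ *
      ∑ z ∈ nbrs d 0, cnd d ω' 0 z * (h ω' - h (shift d z ω'))) * h ω' ∂ν

/-- The set whose supremum is the variational characterization
`⟨f,(−L)⁻¹f⟩_{L²(ν)} = sup_h [2⟨h,f⟩ − ⟨h,(−L)h⟩]` (over bounded continuous `h`);
`⟨f,(−L)⁻¹f⟩_{L²(ν)} < ∞` means this set is bounded above. -/
def invPairSet (d : ℕ) (ν : Measure (EnvSp d)) (f : EnvSp d → ℝ) : Set ℝ :=
  {r | ∃ h : EnvSp d → ℝ, Continuous h ∧ IsBdd d h ∧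
        r = 2 * innerQ d ν h f - quadQ d ν h}

/-- The function `f(ω) = π_ω(0)⁻¹ ∇⋆(c v)(ω)` built from a vector field `v`. -/
def fDiv (d : ℕ) (v : EnvSp d → Fin d → ℝ) (ω : EnvSp d) : ℝ :=
  (piOf d ω 0)⁻¹ *
    ∑ i, (cnd d ω 0 (unitv d i) * v ω i -
          cnd d ω (-(unitv d i)) 0 * v (shift d (-(unitv d i)) ω) i)

/-- The inner product of `ℓ²(Λ,π_ω)`. -/
def innerF (d : ℕ) (ω : EnvSp d) (Λ : Finset (Vert d)) (f g : Vert d → ℝ) : ℝ :=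
  ∑ x ∈ Λ, f x * g x * piOf d ω x

/-- The pairing `⟨h, (−𝖫_ω)h⟩_{ℓ²(Λ,π_ω)}` for `h` vanishing outside `Λ`. -/
def quadF (d : ℕ) (ω : EnvSp d) (Λ : Finset (Vert d)) (h : Vert d → ℝ) : ℝ :=
  ∑ x ∈ Λ, (∑ z ∈ nbrs d x, cnd d ω x z * (h x - h z)) * h x

/-- `⟨f, (−𝖫_ω)⁻¹_Λ f⟩_{ℓ²(Λ,π_ω)}` via its variational characterization
`sup_h [2⟨h,f⟩ − ⟨h,(−𝖫_ω)h⟩]` over `h ∈ ℓ²(Λ,π_ω)`. -/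
def invPairF (d : ℕ) (ω : EnvSp d) (Λ : Finset (Vert d)) (f : Vert d → ℝ) : ℝ :=
  sSup {r | ∃ h : Vert d → ℝ, (∀ x ∉ Λ, h x = 0) ∧
      r = 2 * innerF d ω Λ h f - quadF d ω Λ h}

/-- The antisymmetric edge function `v∘τ(ω)`: the value assigned to the
edge `(x, x+e_i)` is `v_i(τ_x(ω))`. -/
def efield (d : ℕ) (v : EnvSp d → Fin d → ℝ) (ω : EnvSp d) : Vert d → Fin d → ℝ :=
  fun x i => v (shift d x ω) i

/-- The discrete gradient `∇h` of `h : ℤ^d → ℝ` as an edge function. -/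
def dgradE (d : ℕ) (h : Vert d → ℝ) : Vert d → Fin d → ℝ :=
  fun x i => h (x + unitv d i) - h x

/-- The inner product `⟨u,w⟩_{ℓ²(E(Λ), c_ω)}` of (antisymmetric) edge functions;
each unordered edge is counted once, which agrees with the paper's sum over
ordered edges carrying the factor ½. -/
def einner (d : ℕ) (ω : EnvSp d) (Λ : Finset (Vert d)) (u w : Vert d → Fin d → ℝ) : ℝ :=
  ∑ e ∈ edgesIn d Λ, u e.1 e.2 * w e.1 e.2 * ω.1 e

/-- The Dirichlet energy `𝓔_Λ^ω(v)`. -/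
def direnergy (d : ℕ) (ω : EnvSp d) (Λ : Finset (Vert d)) (v : EnvSp d → Fin d → ℝ) : ℝ :=
  sInf {r | ∃ h : Vert d → ℝ, (∀ x ∉ Λ, h x = 0) ∧
      r = einner d ω Λ (fun x i => efield d v ω x i - dgradE d h x i)
            (fun x i => efield d v ω x i - dgradE d h x i)}

/-- The gradient `∇h` of a function on `Ω`. -/
def gradOmega (d : ℕ) (h : EnvSp d → ℝ) : EnvSp d → Fin d → ℝ :=
  fun ω i => h (shift d (unitv d i) ω) - h ω

/-- The inner product `⟨u, c w⟩_{L²(P,ℝ^d)}`. -/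
def cinnerP (d : ℕ) (P : Measure (EnvSp d)) (u w : EnvSp d → Fin d → ℝ) : ℝ :=
  ∑ i, ∫ ω', cnd d ω' 0 (unitv d i) * u ω' i * w ω' i ∂P

/-- Bounded vector fields on `Ω`. -/
def IsBddV (d : ℕ) (v : EnvSp d → Fin d → ℝ) : Prop := ∃ M, ∀ ω i, |v ω i| ≤ M

/-- The space `𝒱 = (ℝ^d)^{ℤ^d}` of vector fields on `ℤ^d`. -/
abbrev VS (d : ℕ) := Vert d → Fin d → ℝ

/-- The empirical measures `μ_r^{ω,v}` built from the minimizers `h_r` of the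
finite-volume Dirichlet energies. -/
def muR (d : ℕ) (ω : EnvSp d) (hr : ℕ → Vert d → ℝ) (r : ℕ) :
    Measure (EnvSp d × VS d) :=
  (((box d ((r : ℝ) + Real.sqrt r)).card : ℝ≥0∞) *
      ((box d (Real.sqrt r)).card : ℝ≥0∞))⁻¹ •
    ∑ z ∈ box d (Real.sqrt r), ∑ x ∈ box d ((r : ℝ) + Real.sqrt r),
      Measure.dirac (shift d (x + z) ω, fun y => dgradE d (hr r) (x + z + y))

/-- The localized conductances `c_ω^R`. -/
def cR (d : ℕ) (ω : EnvSp d) (R : ℝ) (e : EdgeIx d) : ℝ :=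
  if e ∈ edgesIn d (box d (2 * R)) then ω.1 e else 1

/-- The localized measure `π_ω^R`. -/
def piRloc (d : ℕ) (ω : EnvSp d) (R : ℝ) (x : Vert d) : ℝ :=
  if x ∈ box d (2 * R) then piOf d ω x
  else if x ∈ box d (4 * R) then 1 + piOf d ω x else 1

/-- The localized Dirichlet form `D_ω^R(f,f)` (each unordered edge counted once). -/
def DR (d : ℕ) (ω : EnvSp d) (R : ℝ) (f : Vert d → ℝ) : ℝ≥0∞ :=
  ∑' e : EdgeIx d, ENNReal.ofReal (cR d ω R e * (f (e.1 + unitv d e.2) - f e.1) ^ 2)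

/-- The norm `‖f‖_{ℓ^s(μ)}`. -/
def lpN (d : ℕ) (μw : Vert d → ℝ) (s : ℝ) (f : Vert d → ℝ) : ℝ≥0∞ :=
  (∑' x : Vert d, ENNReal.ofReal (|f x| ^ s * μw x)) ^ (1 / s)

/-- The exponent `ε = 2(2/d − 1/p − 1/q)((d−2)/d + 1/q)⁻¹`. -/
def epsPQ (d : ℕ) (p q : ℝ) : ℝ :=
  2 * (2 / (d : ℝ) - 1 / p - 1 / q) / (((d : ℝ) - 2) / (d : ℝ) + 1 / q)

/-- Jump rates of the localized constant-speed chain `Y^R`: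
rate `c_ω^R(x,y)/π_ω^R(x)` from `x` to `y`. -/
def rateR (d : ℕ) (ω : EnvSp d) (R : ℝ) (x y : Vert d) : ℝ :=
  (∑ i, ((if y = x + unitv d i then cR d ω R (x, i) else 0) +
         (if x = y + unitv d i then cR d ω R (y, i) else 0))) / piRloc d ω R x

/-- The generator matrix of `Y^R`. -/
def qmatR (d : ℕ) (ω : EnvSp d) (R : ℝ) (x y : Vert d) : ℝ :=
  if x = y then -(∑ z ∈ nbrs d x, rateR d ω R x z) else rateR d ω R x y

/-- Iterates of the generator matrix of `Y^R`. -/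
def qiter (d : ℕ) (ω : EnvSp d) (R : ℝ) : ℕ → Vert d → Vert d → ℝ
  | 0, x, y => if x = y then 1 else 0
  | n+1, x, y => ∑ z ∈ insert x (nbrs d x), qmatR d ω R x z * qiter d ω R n z y

/-- The heat kernel `P_ω^x(Y_t^R = y) = (e^{tQ})(x,y)` of the localized chain `Y^R`. -/
def hkR (d : ℕ) (ω : EnvSp d) (R : ℝ) (t : ℝ) (x y : Vert d) : ℝ :=
  ∑' k : ℕ, t ^ k / (Nat.factorial k : ℝ) * qiter d ω R k x y

section Basics

variable {d : ℕ}

instance : TopologicalSpace.PseudoMetrizableSpace (EnvSp d) :=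
  IsInducing.subtypeVal.pseudoMetrizableSpace

instance : HasOuterApproxClosed (EnvSp d) := by
  let := TopologicalSpace.pseudoMetrizableSpacePseudoMetric (EnvSp d)
  infer_instance

lemma continuous_shift (x : Vert d) : Continuous (shift d x) :=
  Continuous.subtype_mk (continuous_pi fun e => (continuous_apply (e.1 + x, e.2)).comp
    continuous_subtype_val) _

lemma measurable_shift (x : Vert d) : Measurable (shift d x) :=
  (continuous_shift x).measurable

lemma shift_shift (x y : Vert d) (ω : EnvSp d) :
    shift d x (shift d y ω) = shift d (x + y) ω := by
  apply Subtype.ext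
  funext e
  simp [shift, add_assoc]

lemma shift_zero (ω : EnvSp d) : shift d 0 ω = ω := by
  apply Subtype.ext
  funext e
  simp [shift]

lemma unitv_injective : Function.Injective (unitv d) := fun i j h => by
  have := congrFun h i
  by_contra hij
  simp [unitv, hij] at this

lemma add_unitv_ne (i j : Fin d) : unitv d i + unitv d j ≠ 0 := fun h => by
  have := congrFun h i
  simp only [unitv, Pi.add_apply, if_true, Pi.zero_apply] at this
  split_ifs at this <;> omega

lemma cnd_zero_unitv (ω : EnvSp d) (i : Fin d) : cnd d ω 0 (unitv d i) = ω.1 (0, i) := by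
  have h1 : ∀ j, (0 : Vert d) ≠ unitv d i + unitv d j := fun j h => add_unitv_ne i j h.symm
  simp [cnd, h1, unitv_injective.eq_iff]

/-- The conductance of the edge `(0, e i)`. -/
def edgeCnd (d : ℕ) (i : Fin d) (ω : EnvSp d) : ℝ := ω.1 (0, i)

lemma edgeCnd_pos (i : Fin d) (ω : EnvSp d) : 0 < edgeCnd d i ω := ω.2 _

lemma continuous_edgeCnd (i : Fin d) : Continuous (edgeCnd d i) :=
  (continuous_apply (0, i)).comp continuous_subtype_val

lemma edgeCnd_shift (i : Fin d) (x : Vert d) (ω : EnvSp d) :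
    edgeCnd d i (shift d x ω) = ω.1 (x, i) := by
  simp [edgeCnd, shift]

end Basics

section Boxes

variable {d : ℕ}

lemma mem_box {n : ℕ} {x : Vert d} : x ∈ box d (n : ℝ) ↔ ∀ i, |x i| ≤ n := by
  have h : ⌈-(n : ℝ)⌉ = -(n : ℤ) := by
    rw [Int.ceil_neg, Int.floor_natCast]
  simp [box, h, abs_le]

lemma card_box (n : ℕ) : (box d (n : ℝ)).card = (2 * n + 1) ^ d := by
  have h : ⌈-(n : ℝ)⌉ = -(n : ℤ) := by
    rw [Int.ceil_neg, Int.floor_natCast]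
  have h2 : ((n : ℤ) + 1 + n).toNat = 2 * n + 1 := by omega
  simp [box, h, h2]

/-- The number of vertices of `Λ_n`, as a real number. -/
def vol (d n : ℕ) : ℝ := ((box d (n : ℝ)).card : ℝ)

lemma vol_eq (n : ℕ) : vol d n = (2 * n + 1 : ℝ) ^ d := by
  simp [vol, card_box]

lemma vol_pos (n : ℕ) : 0 < vol d n := by rw [vol_eq]; positivity

lemma vol_ne_zero (n : ℕ) : vol d n ≠ 0 := (vol_pos n).ne'

lemma box_mono {m n : ℕ} (h : m ≤ n) : box d (m : ℝ) ⊆ box d (n : ℝ) := fun x hx => by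
  rw [mem_box] at *
  intro i
  exact (hx i).trans (by exact_mod_cast h)

lemma vol_mono {m n : ℕ} (h : m ≤ n) : vol d m ≤ vol d n := by
  unfold vol
  exact_mod_cast Finset.card_le_card (box_mono h)

lemma pow_le_vol (n : ℕ) : (n : ℝ) ^ d ≤ vol d n := by
  rw [vol_eq]
  gcongr
  linarith [(Nat.cast_nonneg n : (0 : ℝ) ≤ n)]

lemma abs_unitv_le (i j : Fin d) : |unitv d i j| ≤ 1 := by
  unfold unitv; split_ifs <;> simp

lemma add_mem_box {m k : ℕ} {x y : Vert d} (hx : x ∈ box d (m : ℝ)) (hy : y ∈ box d (k : ℝ)) :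
    x + y ∈ box d ((m + k : ℕ) : ℝ) := by
  rw [mem_box] at *
  intro i
  push_cast
  exact (abs_add_le _ _).trans (add_le_add (hx i) (hy i))

lemma neg_mem_box {m : ℕ} {x : Vert d} (hx : x ∈ box d (m : ℝ)) : -x ∈ box d (m : ℝ) := by
  rw [mem_box] at *
  intro i
  simpa using hx i

lemma unitv_mem_box (i : Fin d) : unitv d i ∈ box d ((1 : ℕ) : ℝ) := by
  rw [mem_box]
  intro j
  simpa using abs_unitv_le i j

lemma exists_mem_box (x : Vert d) : ∃ k : ℕ, x ∈ box d (k : ℝ) := by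
  refine ⟨∑ i, (x i).natAbs, ?_⟩
  rw [mem_box]
  intro i
  have : (x i).natAbs ≤ ∑ i, (x i).natAbs :=
    Finset.single_le_sum (f := fun i => (x i).natAbs) (fun _ _ => Nat.zero_le _)
      (Finset.mem_univ i)
  rw [Int.abs_eq_natAbs]
  exact_mod_cast this

lemma mem_edgesIn {Λ : Finset (Vert d)} {e : EdgeIx d} :
    e ∈ edgesIn d Λ ↔ e.1 ∈ Λ ∨ e.1 + unitv d e.2 ∈ Λ := by
  obtain ⟨x, i⟩ := e
  simp only [edgesIn, Finset.mem_biUnion, Finset.mem_union, Finset.mem_image, Finset.mem_univ,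
    true_and, Prod.mk.injEq]
  constructor
  · rintro ⟨y, hy, ⟨j, rfl, rfl⟩ | ⟨j, rfl, rfl⟩⟩
    · exact Or.inl hy
    · right; simpa using hy
  · rintro (h | h)
    · exact ⟨x, h, Or.inl ⟨i, rfl, rfl⟩⟩
    · exact ⟨_, h, Or.inr ⟨i, by simp, rfl⟩⟩

lemma edgesIn_subset (n : ℕ) :
    edgesIn d (box d (n : ℝ)) ⊆ box d ((n + 1 : ℕ) : ℝ) ×ˢ Finset.univ := by
  intro e he
  rw [mem_edgesIn] at he
  simp only [Finset.mem_product, Finset.mem_univ, and_true]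
  rcases he with h | h
  · exact box_mono (Nat.le_succ n) h
  · have := add_mem_box h (neg_mem_box (unitv_mem_box e.2))
    simpa using this

lemma one_add_pow_le (k : ℕ) {t : ℝ} (h0 : 0 ≤ t) (h1 : t ≤ 1) :
    (1 + t) ^ k ≤ 1 + (2 ^ k - 1) * t := by
  induction k with
  | zero => simp
  | succ k ih =>
    have h2 : (1 : ℝ) ≤ 2 ^ k := one_le_pow₀ (by norm_num)
    calc (1 + t) ^ (k + 1) = (1 + t) ^ k * (1 + t) := pow_succ _ _
      _ ≤ (1 + (2 ^ k - 1) * t) * (1 + t) := by gcongr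
      _ ≤ 1 + (2 ^ (k + 1) - 1) * t := by
        rw [pow_succ]
        nlinarith [mul_nonneg (sub_nonneg.2 h2) (mul_nonneg h0 (sub_nonneg.2 h1))]

/-- The boundary layers of boxes have relative size `O(1/n)`. -/
lemma vol_add_sub_le {n k : ℕ} (hk : 1 ≤ n) (h : k ≤ n) :
    vol d (n + k) - vol d n ≤ 2 ^ d * k / n * vol d n := by
  have hn : (0 : ℝ) < n := by exact_mod_cast hk
  have hkn : (k : ℝ) ≤ n := by exact_mod_cast h
  have hk0 : (0 : ℝ) ≤ k := Nat.cast_nonneg k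
  have e : vol d (n + k) = (1 + 2 * k / (2 * n + 1)) ^ d * vol d n := by
    rw [vol_eq, vol_eq, ← mul_pow]
    congr 1
    push_cast
    field_simp
    ring
  have ht : 2 * (k : ℝ) / (2 * n + 1) ≤ k / n := by
    rw [div_le_div_iff₀ (by positivity) hn]
    nlinarith
  have ht1 : (k : ℝ) / n ≤ 1 := (div_le_one hn).2 hkn
  have ht0 : (0 : ℝ) ≤ k / n := by positivity
  have h2 : (1 + 2 * (k : ℝ) / (2 * n + 1)) ^ d ≤ 1 + 2 ^ d * (k / n) := by
    calc (1 + 2 * (k : ℝ) / (2 * n + 1)) ^ d ≤ (1 + k / n) ^ d := by gcongr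
      _ ≤ 1 + (2 ^ d - 1) * (k / n) := one_add_pow_le d ht0 ht1
      _ ≤ _ := by nlinarith
  have := mul_le_mul_of_nonneg_right h2 (vol_pos (d := d) n).le
  rw [← e] at this
  rw [mul_div_assoc]
  linarith

lemma tendsto_vol_add_div (k : ℕ) :
    Tendsto (fun n : ℕ => vol d (n + k) / vol d n) atTop (𝓝 1) := by
  have h1 : Tendsto (fun n : ℕ => 1 + 2 ^ d * (k : ℝ) / n) atTop (𝓝 1) := by
    have := (tendsto_const_div_atTop_nhds_zero_nat ((2 : ℝ) ^ d * k)).const_add 1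
    simpa using this
  refine tendsto_of_tendsto_of_tendsto_of_le_of_le' tendsto_const_nhds h1 ?_ ?_
  · exact Eventually.of_forall fun n => (one_le_div (vol_pos n)).2 (vol_mono (Nat.le_add_right n k))
  · filter_upwards [eventually_ge_atTop (max 1 k)] with n hn
    rw [div_le_iff₀ (vol_pos n)]
    have := vol_add_sub_le (d := d) (le_of_max_le_left hn) (le_of_max_le_right hn)
    linarith

lemma sum_box_shift_subset {n k : ℕ} {x : Vert d} (hx : x ∈ box d (k : ℝ)) (a : Vert d → ℝ)
    (M : ℝ) (ha : ∀ y, |a y| ≤ M) :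
    |∑ y ∈ box d ((n + k : ℕ) : ℝ), a y - ∑ y ∈ box d (n : ℝ), a (y + x)|
      ≤ M * (vol d (n + k) - vol d n) := by
  classical
  have e : ∑ y ∈ box d (n : ℝ), a (y + x)
      = ∑ y ∈ (box d (n : ℝ)).map (addRightEmbedding x), a y := by simp
  have hsub : (box d (n : ℝ)).map (addRightEmbedding x) ⊆ box d ((n + k : ℕ) : ℝ) := by
    intro y hy
    rw [Finset.mem_map] at hy
    obtain ⟨z, hz, rfl⟩ := hy
    exact add_mem_box hz hx
  rw [e, ← Finset.sum_sdiff hsub, add_sub_cancel_right]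
  refine (Finset.abs_sum_le_sum_abs _ _).trans ((Finset.sum_le_sum fun y _ => ha y).trans ?_)
  rw [Finset.sum_const, nsmul_eq_mul, Finset.cast_card_sdiff hsub, Finset.card_map, mul_comm]
  rfl

lemma zero_mem_box (k : ℕ) : (0 : Vert d) ∈ box d (k : ℝ) := by
  rw [mem_box]; simp

lemma abs_sum_box_shift_sub_le {n k : ℕ} {x : Vert d} (hx : x ∈ box d (k : ℝ)) (a : Vert d → ℝ)
    (M : ℝ) (ha : ∀ y, |a y| ≤ M) :
    |∑ y ∈ box d (n : ℝ), a (y + x) - ∑ y ∈ box d (n : ℝ), a y|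
      ≤ 2 * M * (vol d (n + k) - vol d n) := by
  have h1 := sum_box_shift_subset (n := n) hx a M ha
  have h2 := sum_box_shift_subset (n := n) (zero_mem_box k) a M ha
  simp only [add_zero] at h2
  rw [abs_le] at *
  constructor <;> linarith [h1.1, h1.2, h2.1, h2.2]

end Boxes

section Averages

variable {d : ℕ} {ω : EnvSp d} {P : Measure (EnvSp d)}

lemma avgTo.add {f : EnvSp d → ℝ} {L : ℝ} (hf : avgTo d ω f L) (k : ℕ) :
    Tendsto (fun n : ℕ => (∑ x ∈ box d ((n + k : ℕ) : ℝ), f (shift d x ω)) / vol d n)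
      atTop (𝓝 L) := by
  have h1 : Tendsto (fun n : ℕ => (∑ x ∈ box d ((n + k : ℕ) : ℝ), f (shift d x ω)) / vol d (n + k))
      atTop (𝓝 L) := (tendsto_add_atTop_iff_nat (f := fun n : ℕ =>
        (∑ x ∈ box d (n : ℝ), f (shift d x ω)) / vol d n) k).2 hf
  have h2 := h1.mul (tendsto_vol_add_div (d := d) k)
  rw [mul_one] at h2
  refine h2.congr fun n => ?_
  field_simp [vol_ne_zero (d := d) n, vol_ne_zero (d := d) (n + k)]

lemma avgTo.pred {f : EnvSp d → ℝ} {L : ℝ} (hf : avgTo d ω f L) :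
    Tendsto (fun n : ℕ => (∑ x ∈ box d ((n - 1 : ℕ) : ℝ), f (shift d x ω)) / vol d n)
      atTop (𝓝 L) := by
  rw [← tendsto_add_atTop_iff_nat 1]
  have h2 := hf.div (tendsto_vol_add_div (d := d) 1) one_ne_zero
  rw [div_one] at h2
  refine h2.congr fun n => ?_
  change (_ / vol d n) / _ = _
  simp only [Nat.add_sub_cancel]
  field_simp [vol_ne_zero (d := d) n, vol_ne_zero (d := d) (n + 1)]

/-- The map `t ↦ t - min t M` is controlled by a power of `t`. -/
lemma sub_min_le_rpow {t M s : ℝ} (ht : 0 ≤ t) (hM : 0 < M) (hs : 1 < s) :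
    t - min t M ≤ M ^ (1 - s) * t ^ s := by
  rcases le_total t M with h | h
  · rw [min_eq_left h, sub_self]
    positivity
  · have ht' : 0 < t := hM.trans_le h
    have h1 : t = t ^ (1 - s) * t ^ s := by
      rw [← Real.rpow_add ht']; simp
    have h2 : t ^ (1 - s) ≤ M ^ (1 - s) :=
      Real.rpow_le_rpow_of_nonpos hM h (by linarith)
    have h3 : t ^ (1 - s) * t ^ s ≤ M ^ (1 - s) * t ^ s :=
      mul_le_mul_of_nonneg_right h2 (by positivity)
    rw [min_eq_right h]
    linarith

variable {g : EnvSp d → ℝ} {s C : ℝ}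

lemma isBdd_min (hg0 : ∀ ω', 0 < g ω') {M : ℝ} (hM : 0 < M) :
    IsBdd d fun ω' => min (g ω') M :=
  ⟨M, fun ω' => by rw [abs_of_pos (lt_min (hg0 ω') hM)]; exact min_le_right _ _⟩

/-- A weight whose `s`-th powers have bounded block averages is integrable under `ℙ_ω`. -/
lemma integrable_of_moment (hP : IsEnvLaw d ω P) (hg : Continuous g) (hg0 : ∀ ω', 0 < g ω')
    (hs : 1 < s) (hC : ∀ n : ℕ, 1 ≤ n → ∑ x ∈ box d (n : ℝ), g (shift d x ω) ^ s ≤ C * vol d n) :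
    Integrable g P := by
  have := hP.1
  have hbound : ∀ M : ℕ, ∫ ω', min (g ω') (M + 1 : ℝ) ∂P ≤ 1 + C := by
    intro M
    have hM : (0 : ℝ) < M + 1 := by positivity
    refine le_of_tendsto (hP.2 _ (hg.min continuous_const) (isBdd_min hg0 hM)) ?_
    filter_upwards [eventually_ge_atTop 1] with n hn
    change _ / vol d n ≤ _
    rw [div_le_iff₀ (vol_pos n)]
    calc ∑ x ∈ box d (n : ℝ), min (g (shift d x ω)) (M + 1 : ℝ)
        ≤ ∑ x ∈ box d (n : ℝ), (1 + g (shift d x ω) ^ s) := by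
          refine Finset.sum_le_sum fun x _ => (min_le_left _ _).trans ?_
          rcases le_total (g (shift d x ω)) 1 with h | h
          · have := Real.rpow_nonneg (hg0 (shift d x ω)).le s
            linarith
          · have := Real.self_le_rpow_of_one_le h hs.le
            linarith
      _ = vol d n + ∑ x ∈ box d (n : ℝ), g (shift d x ω) ^ s := by
          rw [Finset.sum_add_distrib]; simp [vol]
      _ ≤ (1 + C) * vol d n := by linarith [hC n hn]
  have hint : ∀ M : ℕ, Integrable (fun ω' => min (g ω') (M + 1 : ℝ)) P := fun M => by
    obtain ⟨K, hK⟩ := isBdd_min hg0 (show (0 : ℝ) < M + 1 by positivity)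
    exact Integrable.of_bound (hg.min continuous_const).aestronglyMeasurable K
      (Eventually.of_forall fun ω' => by simpa [Real.norm_eq_abs] using hK ω')
  have hlim : Tendsto (fun M : ℕ => ∫⁻ ω', ENNReal.ofReal (min (g ω') (M + 1 : ℝ)) ∂P) atTop
      (𝓝 (∫⁻ ω', ENNReal.ofReal (g ω') ∂P)) := by
    refine lintegral_tendsto_of_tendsto_of_monotone
      (fun M => ((hg.min continuous_const).measurable.ennreal_ofReal).aemeasurable) ?_ ?_
    · refine Eventually.of_forall fun ω' M N h => ENNReal.ofReal_le_ofReal ?_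
      have : (M : ℝ) ≤ N := by exact_mod_cast h
      exact min_le_min le_rfl (by linarith)
    · refine Eventually.of_forall fun ω' => ?_
      refine tendsto_const_nhds.congr' ?_
      filter_upwards [eventually_ge_atTop ⌈g ω'⌉₊] with M hM
      rw [min_eq_left]
      have := (Nat.le_ceil (g ω')).trans (Nat.cast_le.2 hM)
      linarith
  have hle : ∫⁻ ω', ENNReal.ofReal (g ω') ∂P ≤ ENNReal.ofReal (1 + C) := by
    refine le_of_tendsto hlim (Eventually.of_forall fun M => ?_)
    rw [← ofReal_integral_eq_lintegral_ofReal (hint M) (Eventually.of_forall fun ω' =>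
      (lt_min (hg0 ω') (by positivity)).le)]
    exact ENNReal.ofReal_le_ofReal (hbound M)
  refine ⟨hg.aestronglyMeasurable, ?_⟩
  rw [hasFiniteIntegral_iff_ofReal (Eventually.of_forall fun ω' => (hg0 ω').le)]
  exact hle.trans_lt ENNReal.ofReal_lt_top

lemma IsBdd.exists_pos {φ : EnvSp d → ℝ} (h : IsBdd d φ) : ∃ M, 0 < M ∧ ∀ ω', |φ ω'| ≤ M := by
  obtain ⟨M, hM⟩ := h
  exact ⟨max M 1, by positivity, fun ω' => (hM ω').trans (le_max_left _ _)⟩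

lemma IsBdd.mul {φ ψ : EnvSp d → ℝ} (h : IsBdd d φ) (h' : IsBdd d ψ) :
    IsBdd d fun ω' => φ ω' * ψ ω' := by
  obtain ⟨M, hM0, hM⟩ := h.exists_pos
  obtain ⟨N, hN⟩ := h'
  exact ⟨M * N, fun ω' => by rw [abs_mul]; gcongr; exacts [hM ω', hN ω']⟩

lemma IsBdd.add {φ ψ : EnvSp d → ℝ} (h : IsBdd d φ) (h' : IsBdd d ψ) :
    IsBdd d fun ω' => φ ω' + ψ ω' := by
  obtain ⟨M, hM⟩ := h
  obtain ⟨N, hN⟩ := h'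
  exact ⟨M + N, fun ω' => (abs_add_le _ _).trans (add_le_add (hM ω') (hN ω'))⟩

lemma IsBdd.sub {φ ψ : EnvSp d → ℝ} (h : IsBdd d φ) (h' : IsBdd d ψ) :
    IsBdd d fun ω' => φ ω' - ψ ω' := by
  obtain ⟨M, hM⟩ := h
  obtain ⟨N, hN⟩ := h'
  exact ⟨M + N, fun ω' => (abs_sub _ _).trans (add_le_add (hM ω') (hN ω'))⟩

lemma IsBdd.comp {φ : EnvSp d → ℝ} (h : IsBdd d φ) (x : Vert d) :
    IsBdd d fun ω' => φ (shift d x ω') := by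
  obtain ⟨M, hM⟩ := h
  exact ⟨M, fun ω' => hM _⟩

lemma IsBdd.integrable_mul {μ : Measure (EnvSp d)} {φ f : EnvSp d → ℝ} (h : IsBdd d φ)
    (hφ : Measurable φ) (hf : Integrable f μ) : Integrable (fun ω' => φ ω' * f ω') μ := by
  obtain ⟨M, hM⟩ := h
  exact hf.bdd_mul hφ.aestronglyMeasurable (c := M)
    (Eventually.of_forall fun ω' => by simpa [Real.norm_eq_abs] using hM ω')

/-- Block averages of a bounded continuous function times a weight with a moment bound. -/
lemma avgTo_mul_of_moment (hP : IsEnvLaw d ω P) (hg : Continuous g) (hg0 : ∀ ω', 0 < g ω')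
    (hs : 1 < s) (hC : ∀ n : ℕ, 1 ≤ n → ∑ x ∈ box d (n : ℝ), g (shift d x ω) ^ s ≤ C * vol d n)
    {φ : EnvSp d → ℝ} (hφ : Continuous φ) (hφb : IsBdd d φ) :
    avgTo d ω (fun ω' => φ ω' * g ω') (∫ ω', φ ω' * g ω' ∂P) := by
  have := hP.1
  have hgi := integrable_of_moment hP hg hg0 hs hC
  obtain ⟨K, hK0, hK⟩ := hφb.exists_pos
  have hC0 : 0 ≤ C := by
    have h1 := hC 1 le_rfl
    have h2 : 0 ≤ ∑ x ∈ box d ((1 : ℕ) : ℝ), g (shift d x ω) ^ s :=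
      Finset.sum_nonneg fun x _ => Real.rpow_nonneg (hg0 _).le s
    exact nonneg_of_mul_nonneg_left (h2.trans h1) (vol_pos 1)
  have hlimE : Tendsto (fun M : ℕ => ∫ ω', φ ω' * min (g ω') M ∂P) atTop
      (𝓝 (∫ ω', φ ω' * g ω' ∂P)) := by
    refine tendsto_integral_of_dominated_convergence (fun ω' => K * g ω')
      (fun M => (hφ.mul (hg.min continuous_const)).aestronglyMeasurable) (hgi.const_mul K) ?_ ?_
    · refine fun M => Eventually.of_forall fun ω' => ?_
      rw [Real.norm_eq_abs, abs_mul, abs_of_nonneg (le_min (hg0 ω').le (Nat.cast_nonneg M))]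
      exact mul_le_mul (hK ω') (min_le_left _ _) (le_min (hg0 ω').le (Nat.cast_nonneg M)) hK0.le
    · refine Eventually.of_forall fun ω' => tendsto_const_nhds.congr' ?_
      filter_upwards [eventually_ge_atTop ⌈g ω'⌉₊] with M hM
      rw [min_eq_left ((Nat.le_ceil (g ω')).trans (Nat.cast_le.2 hM))]
  have hpow : Tendsto (fun M : ℕ => K * ((M : ℝ) ^ (1 - s) * C)) atTop (𝓝 0) := by
    have h1 : Tendsto (fun M : ℕ => (M : ℝ) ^ (-(s - 1))) atTop (𝓝 0) :=
      (tendsto_rpow_neg_atTop (by linarith)).comp tendsto_natCast_atTop_atTop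
    have := (h1.mul_const C).const_mul K
    simpa using this
  rw [avgTo, Metric.tendsto_atTop]
  intro ε hε
  obtain ⟨M, hM1, hM2, hM3⟩ := ((hpow.eventually (gt_mem_nhds (show (0 : ℝ) < ε / 3 by positivity))).and
    ((Metric.tendsto_nhds.1 hlimE (ε / 3) (by positivity)).and (eventually_ge_atTop 1))).exists
  have hMpos : (0 : ℝ) < M := by exact_mod_cast hM3
  have h3 := hP.2 _ (hφ.mul (hg.min continuous_const)) (hφb.mul (isBdd_min hg0 hMpos))
  obtain ⟨N, hN⟩ := Metric.tendsto_atTop.1 h3 (ε / 3) (by positivity)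
  refine ⟨max N 1, fun n hn => ?_⟩
  have hn1 := hN n (le_of_max_le_left hn)
  have hd : |(∑ x ∈ box d (n : ℝ), φ (shift d x ω) * g (shift d x ω)) / vol d n -
      (∑ x ∈ box d (n : ℝ), φ (shift d x ω) * min (g (shift d x ω)) M) / vol d n| ≤
      K * ((M : ℝ) ^ (1 - s) * C) := by
    rw [← sub_div, abs_div, abs_of_pos (vol_pos n), div_le_iff₀ (vol_pos n),
      ← Finset.sum_sub_distrib]
    calc |∑ x ∈ box d (n : ℝ), (φ (shift d x ω) * g (shift d x ω) -
            φ (shift d x ω) * min (g (shift d x ω)) M)|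
        ≤ ∑ x ∈ box d (n : ℝ), K * ((M : ℝ) ^ (1 - s) * g (shift d x ω) ^ s) := by
          refine (Finset.abs_sum_le_sum_abs _ _).trans (Finset.sum_le_sum fun x _ => ?_)
          rw [← mul_sub, abs_mul, abs_of_nonneg (sub_nonneg.2 (min_le_left _ _))]
          exact mul_le_mul (hK _) (sub_min_le_rpow (hg0 _).le hMpos hs)
            (sub_nonneg.2 (min_le_left _ _)) hK0.le
      _ = K * ((M : ℝ) ^ (1 - s) * ∑ x ∈ box d (n : ℝ), g (shift d x ω) ^ s) := by
          rw [Finset.mul_sum, Finset.mul_sum]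
      _ ≤ K * ((M : ℝ) ^ (1 - s) * (C * vol d n)) := by
          gcongr
          exact hC n (le_of_max_le_right hn)
      _ = _ := by ring
  rw [Real.dist_eq] at *
  change |_ / vol d n - _| < _
  change |(∑ x ∈ box d (n : ℝ), φ (shift d x ω) * min (g (shift d x ω)) M) / vol d n -
    ∫ ω', φ ω' * min (g ω') M ∂P| < _ at hn1
  have t1 := abs_sub_le ((∑ x ∈ box d (n : ℝ), φ (shift d x ω) * g (shift d x ω)) / vol d n)
    ((∑ x ∈ box d (n : ℝ), φ (shift d x ω) * min (g (shift d x ω)) M) / vol d n)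
    (∫ ω', φ ω' * g ω' ∂P)
  have t2 := abs_sub_le ((∑ x ∈ box d (n : ℝ), φ (shift d x ω) * min (g (shift d x ω)) M) / vol d n)
    (∫ ω', φ ω' * min (g ω') M ∂P) (∫ ω', φ ω' * g ω' ∂P)
  linarith

lemma moment_of_edges {s : ℝ} (hf : ∃ C : ℝ, ∀ n : ℕ, 1 ≤ n →
      (∑ e ∈ edgesIn d (box d (n : ℝ)), ω.1 e ^ s) / (n : ℝ) ^ d ≤ C) :
    ∃ C : ℝ, ∀ i, ∀ n : ℕ, 1 ≤ n → ∑ x ∈ box d (n : ℝ), edgeCnd d i (shift d x ω) ^ s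
      ≤ C * vol d n := by
  classical
  obtain ⟨C, hC⟩ := hf
  refine ⟨C, fun i n hn => ?_⟩
  have hnpos : (0 : ℝ) < (n : ℝ) ^ d := by positivity
  have h1 := hC n hn
  have hpos : 0 ≤ ∑ e ∈ edgesIn d (box d (n : ℝ)), ω.1 e ^ s :=
    Finset.sum_nonneg fun e _ => Real.rpow_nonneg (ω.2 e).le s
  have hC0 : 0 ≤ C := (div_nonneg hpos hnpos.le).trans h1
  calc ∑ x ∈ box d (n : ℝ), edgeCnd d i (shift d x ω) ^ s
      = ∑ e ∈ (box d (n : ℝ)).image fun x => (x, i), ω.1 e ^ s := by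
        rw [Finset.sum_image fun x _ y _ h => (Prod.mk.inj h).1]
        simp only [edgeCnd_shift]
    _ ≤ ∑ e ∈ edgesIn d (box d (n : ℝ)), ω.1 e ^ s := by
        refine Finset.sum_le_sum_of_subset_of_nonneg ?_ fun e _ _ => Real.rpow_nonneg (ω.2 e).le s
        intro e he
        obtain ⟨x, hx, rfl⟩ := Finset.mem_image.1 he
        exact mem_edgesIn.2 (Or.inl hx)
    _ ≤ C * (n : ℝ) ^ d := (div_le_iff₀ hnpos).1 h1
    _ ≤ C * vol d n := by gcongr; exact pow_le_vol n

lemma continuous_edgeCnd_inv (i : Fin d) : Continuous fun ω' : EnvSp d => (edgeCnd d i ω')⁻¹ :=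
  (continuous_edgeCnd i).inv₀ fun ω' => (edgeCnd_pos i ω').ne'

/-- The consequences of the moment conditions used below. -/
structure Regular (d : ℕ) (ω : EnvSp d) (P : Measure (EnvSp d)) : Prop where
  prob : IsProbabilityMeasure P
  avg : ∀ φ : EnvSp d → ℝ, Continuous φ → IsBdd d φ → avgTo d ω φ (∫ ω', φ ω' ∂P)
  integrable : ∀ i, Integrable (edgeCnd d i) P
  integrable_inv : ∀ i, Integrable (fun ω' => (edgeCnd d i ω')⁻¹) P
  avg_mul : ∀ i, ∀ φ : EnvSp d → ℝ, Continuous φ → IsBdd d φ →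
    avgTo d ω (fun ω' => φ ω' * edgeCnd d i ω') (∫ ω', φ ω' * edgeCnd d i ω' ∂P)
  avg_div : ∀ i, ∀ φ : EnvSp d → ℝ, Continuous φ → IsBdd d φ →
    avgTo d ω (fun ω' => φ ω' * (edgeCnd d i ω')⁻¹) (∫ ω', φ ω' * (edgeCnd d i ω')⁻¹ ∂P)

lemma IsEnvLaw.regular (hP : IsEnvLaw d ω P) {p q : ℝ} (hp : 1 < p) (hq : 1 < q)
    (hmom : InOmegaPQ d p q ω) : Regular d ω P := by
  obtain ⟨C, hC⟩ := moment_of_edges hmom.1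
  obtain ⟨C', hC'⟩ := moment_of_edges hmom.2
  have hC'' : ∀ i, ∀ n : ℕ, 1 ≤ n →
      ∑ x ∈ box d (n : ℝ), ((edgeCnd d i (shift d x ω))⁻¹) ^ q ≤ C' * vol d n := fun i n hn => by
    refine (Finset.sum_congr rfl fun x _ => ?_).trans_le (hC' i n hn)
    rw [Real.inv_rpow (edgeCnd_pos i _).le, Real.rpow_neg (edgeCnd_pos i _).le]
  have hinv : ∀ i, ∀ ω' : EnvSp d, 0 < (edgeCnd d i ω')⁻¹ := fun i ω' => inv_pos.2 (edgeCnd_pos i ω')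
  exact
    { prob := hP.1
      avg := hP.2
      integrable := fun i => integrable_of_moment hP (continuous_edgeCnd i) (edgeCnd_pos i) hp (hC i)
      integrable_inv := fun i =>
        integrable_of_moment hP (continuous_edgeCnd_inv i) (hinv i) hq (hC'' i)
      avg_mul := fun i _ hφ hφb =>
        avgTo_mul_of_moment hP (continuous_edgeCnd i) (edgeCnd_pos i) hp (hC i) hφ hφb
      avg_div := fun i _ hφ hφb =>
        avgTo_mul_of_moment hP (continuous_edgeCnd_inv i) (hinv i) hq (hC'' i) hφ hφb }

/-- The law `ℙ_ω` is invariant under translations. -/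
lemma Regular.measurePreserving (hP : Regular d ω P) (x : Vert d) :
    MeasurePreserving (shift d x) P P := by
  have := hP.prob
  refine ⟨measurable_shift x, ?_⟩
  have := Measure.isProbabilityMeasure_map (μ := P) (measurable_shift x).aemeasurable
  refine ext_of_forall_integral_eq_of_IsFiniteMeasure fun f => ?_
  rw [integral_map (measurable_shift x).aemeasurable f.continuous.aestronglyMeasurable]
  have hfb : IsBdd d f := ⟨‖f‖, fun ω' => f.norm_coe_le_norm ω'⟩
  have h1 := hP.avg f f.continuous hfb
  have h2 := hP.avg (fun ω' => f (shift d x ω')) (f.continuous.comp (continuous_shift x)) (hfb.comp x)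
  obtain ⟨k, hk⟩ := exists_mem_box x
  have h3 : Tendsto (fun n : ℕ => 2 * ‖f‖ * (vol d (n + k) / vol d n - 1)) atTop (𝓝 0) := by
    have := ((tendsto_vol_add_div (d := d) k).sub_const 1).const_mul (2 * ‖f‖)
    simpa using this
  have h4 := squeeze_zero_norm (a := fun n : ℕ => 2 * ‖f‖ * (vol d (n + k) / vol d n - 1))
    (f := fun n : ℕ => (∑ y ∈ box d (n : ℝ), f (shift d x (shift d y ω))) / vol d n -
      (∑ y ∈ box d (n : ℝ), f (shift d y ω)) / vol d n) (fun n => ?_) h3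
  · exact sub_eq_zero.1 (tendsto_nhds_unique (h2.sub h1) h4)
  · have := abs_sum_box_shift_sub_le (n := n) hk (fun y => f (shift d y ω)) ‖f‖
      fun y => f.norm_coe_le_norm _
    rw [← sub_div, norm_div, Real.norm_eq_abs, Real.norm_of_nonneg (vol_pos n).le,
      div_le_iff₀ (vol_pos n)]
    simp only [shift_shift, add_comm x]
    refine this.trans_eq ?_
    field_simp [vol_ne_zero (d := d) n]

end Averages

section HilbertTools

variable {d : ℕ} {μ : Measure (EnvSp d)} [IsFiniteMeasure μ]

lemma exists_bdd_continuous_approx {W : EnvSp d → ℝ} (hW : MemLp W 2 μ) {δ : ℝ} (hδ : 0 < δ) :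
    ∃ φ : EnvSp d → ℝ, Continuous φ ∧ IsBdd d φ ∧ ∫ ω', (W ω' - φ ω') ^ 2 ∂μ ≤ δ := by
  obtain ⟨g, hg, -⟩ := MemLp.exists_boundedContinuous_integral_rpow_sub_le (p := 2) (by norm_num)
    (by simpa using hW) hδ
  refine ⟨g, g.continuous, ⟨‖g‖, g.norm_coe_le_norm⟩, ?_⟩
  simpa using hg

lemma IsBdd.memLp {φ : EnvSp d → ℝ} (h : IsBdd d φ) (hφ : Measurable φ) (r : ℝ≥0∞) :
    MemLp φ r μ := by
  obtain ⟨M, hM⟩ := h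
  exact MemLp.of_bound hφ.aestronglyMeasurable M
    (Eventually.of_forall fun ω' => by simpa [Real.norm_eq_abs] using hM ω')

/-- Riesz representation of a functional on bounded continuous functions that is controlled by
the `L²(μ)`-norm. -/
lemma exists_riesz {S : (EnvSp d → ℝ) → ℝ} {C : ℝ}
    (hadd : ∀ φ ψ, Continuous φ → IsBdd d φ → Continuous ψ → IsBdd d ψ →
      S (fun ω' => φ ω' + ψ ω') = S φ + S ψ)
    (hsmul : ∀ (t : ℝ) φ, Continuous φ → IsBdd d φ → S (fun ω' => t * φ ω') = t * S φ)
    (hbd : ∀ φ, Continuous φ → IsBdd d φ → S φ ^ 2 ≤ C * ∫ ω', φ ω' ^ 2 ∂μ) :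
    ∃ Y : EnvSp d → ℝ, MemLp Y 2 μ ∧
      ∀ φ, Continuous φ → IsBdd d φ → S φ = ∫ ω', φ ω' * Y ω' ∂μ := by
  have hb : ∀ f : BoundedContinuousFunction (EnvSp d) ℝ, IsBdd d f :=
    fun f => ⟨‖f‖, f.norm_coe_le_norm⟩
  let T : BoundedContinuousFunction (EnvSp d) ℝ →ₗ[ℝ] ℝ :=
    { toFun := fun f => S f
      map_add' := fun f g => hadd f g f.continuous (hb f) g.continuous (hb g)
      map_smul' := fun t f => hsmul t f f.continuous (hb f) }
  let e := BoundedContinuousFunction.toLp (E := ℝ) 2 μ ℝ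
  have hdense : DenseRange e := BoundedContinuousFunction.toLp_denseRange ℝ μ ℝ (by norm_num)
  have hnorm : ∀ f, ‖T f‖ ≤ √(max C 0) * ‖e f‖ := fun f => by
    rw [Real.norm_eq_abs, ← Real.sqrt_sq (norm_nonneg (e f)),
      ← Real.sqrt_mul (le_max_right C 0)]
    apply Real.abs_le_sqrt
    have h1 : ‖e f‖ ^ 2 = ∫ ω', f ω' ^ 2 ∂μ := by
      rw [← real_inner_self_eq_norm_sq, L2.inner_def]
      refine integral_congr_ae ?_
      filter_upwards [BoundedContinuousFunction.coeFn_toLp (E := ℝ) 2 μ ℝ f] with a ha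
      change inner ℝ ((BoundedContinuousFunction.toLp (E := ℝ) 2 μ ℝ f) a) _ = _
      rw [ha]
      simp [pow_two]
    rw [h1]
    refine (hbd f f.continuous (hb f)).trans ?_
    exact mul_le_mul_of_nonneg_right (le_max_left _ _) (integral_nonneg fun _ => sq_nonneg _)
  let T' := T.extendOfNorm e.toLinearMap
  have hT' : ∀ f, T' (e f) = T f :=
    fun f => LinearMap.extendOfNorm_eq (e := e.toLinearMap) hdense ⟨_, hnorm⟩ f
  let Y := (InnerProductSpace.toDual ℝ (Lp ℝ 2 μ)).symm T'
  refine ⟨Y, Lp.memLp Y, fun φ hφ hφb => ?_⟩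
  obtain ⟨M, hM⟩ := hφb
  let f : BoundedContinuousFunction (EnvSp d) ℝ :=
    BoundedContinuousFunction.ofNormedAddCommGroup φ hφ M hM
  have h1 : S φ = T' (e f) := (hT' f).symm
  rw [h1, ← InnerProductSpace.toDual_symm_apply (𝕜 := ℝ) (x := e f) (y := T'), L2.inner_def]
  refine integral_congr_ae ?_
  filter_upwards [BoundedContinuousFunction.coeFn_toLp (E := ℝ) 2 μ ℝ f] with a ha
  change inner ℝ _ ((BoundedContinuousFunction.toLp (E := ℝ) 2 μ ℝ f) a) = _
  rw [ha]
  simp [f, Y]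

end HilbertTools

section Ergodic

variable {d : ℕ} {P : Measure (EnvSp d)}

/-- A translation invariant ergodic probability measure on environments. -/
structure StatErg (d : ℕ) (P : Measure (EnvSp d)) : Prop where
  prob : IsProbabilityMeasure P
  mp : ∀ x, MeasurePreserving (shift d x) P P
  ergodic : ErgodicEnv d P

/-- The translation `τ_x` as a measurable equivalence. -/
def shiftEquiv (d : ℕ) (x : Vert d) : EnvSp d ≃ᵐ EnvSp d where
  toFun := shift d x
  invFun := shift d (-x)
  left_inv ω := by rw [shift_shift, neg_add_cancel, shift_zero]
  right_inv ω := by rw [shift_shift, add_neg_cancel, shift_zero]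
  measurable_toFun := measurable_shift x
  measurable_invFun := measurable_shift (-x)

lemma integral_shift (hP : StatErg d P) (x : Vert d) (f : EnvSp d → ℝ) :
    ∫ ω, f (shift d x ω) ∂P = ∫ ω, f ω ∂P :=
  (hP.mp x).integral_comp (shiftEquiv d x).measurableEmbedding f

lemma integrable_shift (hP : StatErg d P) (x : Vert d) {f : EnvSp d → ℝ} (hf : Integrable f P) :
    Integrable (fun ω => f (shift d x ω)) P :=
  (hP.mp x).integrable_comp_of_integrable hf

/-- Almost sure statements may be translated. -/
lemma ae_shift (hP : StatErg d P) (x : Vert d) {p : EnvSp d → Prop} (h : ∀ᵐ ω ∂P, p ω) :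
    ∀ᵐ ω ∂P, p (shift d x ω) :=
  (hP.mp x).quasiMeasurePreserving.ae h

/-- An integrable function of mean zero that is a.s. invariant under all translations vanishes. -/
lemma ae_zero_of_invariant (hP : StatErg d P) {G : EnvSp d → ℝ} (hG : Integrable G P)
    (hinv : ∀ x, ∀ᵐ ω ∂P, G (shift d x ω) = G ω) (h0 : ∫ ω, G ω ∂P = 0) : G =ᵐ[P] 0 := by
  have := hP.prob
  have key : ∀ F : EnvSp d → ℝ, Integrable F P → (∀ x, ∀ᵐ ω ∂P, F (shift d x ω) = F ω) →
      ∫ ω, F ω ∂P = 0 → ∀ᵐ ω ∂P, F ω ≤ 0 := by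
    intro F hF hFi hF0
    let F' := hF.1.mk F
    have hFF' : F =ᵐ[P] F' := hF.1.ae_eq_mk
    have hF'm : Measurable F' := hF.1.stronglyMeasurable_mk.measurable
    let A : Set (EnvSp d) := {ω | ∀ x, 0 < F' (shift d x ω)}
    have hAm : MeasurableSet A := by
      have : A = ⋂ x, (fun ω => F' (shift d x ω)) ⁻¹' Set.Ioi 0 := by ext; simp [A]
      rw [this]
      exact MeasurableSet.iInter fun x => (hF'm.comp (measurable_shift x)) measurableSet_Ioi
    have hAinv : ∀ x, shift d x ⁻¹' A = A := by
      intro x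
      ext ω
      simp only [A, Set.mem_preimage, Set.mem_ofPred_eq, shift_shift]
      exact ⟨fun h y => by simpa using h (y - x), fun h y => h _⟩
    have hAF : ∀ᵐ ω ∂P, ω ∈ A ↔ 0 < F ω := by
      have h1 : ∀ᵐ ω ∂P, ∀ x, F' (shift d x ω) = F ω := by
        rw [ae_all_iff]
        intro x
        filter_upwards [hFi x, ae_shift hP x hFF'] with ω h1 h2
        rw [← h2, h1]
      filter_upwards [h1] with ω h
      simp [A, h]
    rcases hP.ergodic A hAm hAinv with h | h
    · filter_upwards [hAF, measure_eq_zero_iff_ae_notMem.1 h] with ω h1 h2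
      exact not_lt.1 fun h3 => h2 (h1.2 h3)
    · have h1 : ∀ᵐ ω ∂P, 0 < F ω := by
        filter_upwards [hAF, (prob_compl_eq_zero_iff hAm).2 h |> measure_eq_zero_iff_ae_notMem.1]
          with ω h1 h2
        exact h1.1 (by simpa using h2)
      have h2 := (integral_eq_zero_iff_of_nonneg_ae (h1.mono fun ω h => h.le) hF).1 hF0
      filter_upwards [h1, h2] with ω a b
      simp only [Pi.zero_apply] at b
      linarith
  have h1 := key G hG hinv h0
  have h2 := key (fun ω => -G ω) hG.neg (fun x => (hinv x).mono fun ω h => by rw [h])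
    (by rw [integral_neg, h0, neg_zero])
  filter_upwards [h1, h2] with ω a b
  simp only [Pi.zero_apply]
  linarith

/-- Time averages along the direction `e`. -/
def dirAvg (d : ℕ) (e : Vert d) (n : ℕ) (f : EnvSp d → ℝ) (ω : EnvSp d) : ℝ :=
  (n : ℝ)⁻¹ * ∑ t ∈ Finset.range n, f (shift d (t • e) ω)

lemma integrable_dirAvg (hP : StatErg d P) (e : Vert d) (n : ℕ) {f : EnvSp d → ℝ}
    (hf : Integrable f P) : Integrable (dirAvg d e n f) P :=
  (integrable_finsetSum _ fun _ _ => integrable_shift hP _ hf).const_mul _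

lemma integral_abs_dirAvg_le (hP : StatErg d P) (e : Vert d) (n : ℕ) {f : EnvSp d → ℝ}
    (hf : Integrable f P) : ∫ ω, |dirAvg d e n f ω| ∂P ≤ ∫ ω, |f ω| ∂P := by
  have h1 : ∀ ω, |dirAvg d e n f ω| ≤ dirAvg d e n (fun ω => |f ω|) ω := fun ω => by
    unfold dirAvg
    rw [abs_mul, abs_of_nonneg (inv_nonneg.2 (Nat.cast_nonneg n))]
    gcongr
    exact Finset.abs_sum_le_sum_abs _ _
  refine (integral_mono (integrable_dirAvg hP e n hf).abs (integrable_dirAvg hP e n hf.abs)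
    h1).trans ?_
  unfold dirAvg
  rw [integral_const_mul, integral_finsetSum _ fun _ _ => integrable_shift hP _ hf.abs]
  simp_rw [integral_shift hP _ fun ω => |f ω|]
  rw [Finset.sum_const, Finset.card_range, nsmul_eq_mul, ← mul_assoc]
  rcases Nat.eq_zero_or_pos n with rfl | hn
  · simpa using integral_nonneg fun ω => abs_nonneg (f ω)
  · rw [inv_mul_cancel₀ (by positivity), one_mul]

lemma dirAvg_sub (e : Vert d) (n : ℕ) (f g : EnvSp d → ℝ) (ω : EnvSp d) :
    dirAvg d e n (fun ω => f ω - g ω) ω = dirAvg d e n f ω - dirAvg d e n g ω := by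
  simp [dirAvg, Finset.sum_sub_distrib, mul_sub]

lemma integral_abs_sub_le_sqrt [IsProbabilityMeasure P] {f : EnvSp d → ℝ} (hf : MemLp f 2 P) :
    ∫ ω, |f ω| ∂P ≤ (eLpNorm f 2 P).toReal := by
  have h1 : eLpNorm f 1 P ≤ eLpNorm f 2 P :=
    eLpNorm_le_eLpNorm_of_exponent_le (by norm_num) hf.1
  have h2 := ENNReal.toReal_mono hf.2.ne h1
  rwa [eLpNorm_one_eq_lintegral_enorm, ← integral_norm_eq_lintegral_enorm hf.1] at h2

/-- Von Neumann's theorem for bounded functions. -/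
lemma dirAvg_cauchy_of_bdd (hP : StatErg d P) (e : Vert d) {g : EnvSp d → ℝ} (hg : Measurable g)
    (hgb : IsBdd d g) {ε : ℝ} (hε : 0 < ε) :
    ∃ N : ℕ, ∀ n ≥ N, ∀ m ≥ N, ∫ ω, |dirAvg d e n g ω - dirAvg d e m g ω| ∂P ≤ ε := by
  have := hP.prob
  let U := (Lp.compMeasurePreservingₗᵢ ℝ (E := ℝ) (p := 2) (shift d e) (hP.mp e))
  have hgL : MemLp g 2 P := hgb.memLp hg 2
  have hiter : ∀ t : ℕ, (U^[t] hgL.toLp : Lp ℝ 2 P) =ᵐ[P] fun ω => g (shift d (t • e) ω) := by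
    intro t
    induction t with
    | zero =>
      filter_upwards [hgL.coeFn_toLp] with ω h
      simpa [shift_zero] using h
    | succ t ih =>
      rw [Function.iterate_succ_apply']
      filter_upwards [Lp.coeFn_compMeasurePreserving (U^[t] hgL.toLp) (hP.mp e), ae_shift hP e ih]
        with ω h1 h2
      refine h1.trans (h2.trans ?_)
      rw [shift_shift, succ_nsmul]
  have havg : ∀ n : ℕ, (birkhoffAverage ℝ U _root_.id n hgL.toLp : Lp ℝ 2 P) =ᵐ[P]
      dirAvg d e n g := by
    intro n
    have hsum : (birkhoffSum U _root_.id n hgL.toLp : Lp ℝ 2 P) =ᵐ[P]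
        fun ω => ∑ t ∈ Finset.range n, g (shift d (t • e) ω) := by
      induction n with
      | zero =>
        rw [birkhoffSum_zero]
        simpa using (Lp.coeFn_zero ℝ 2 P).trans (EventuallyEq.refl _ fun _ => (0 : ℝ))
      | succ n ih =>
        rw [birkhoffSum_succ]
        filter_upwards [Lp.coeFn_add (birkhoffSum U _root_.id n hgL.toLp) (U^[n] hgL.toLp), ih,
          hiter n] with ω h1 h2 h3
        rw [Finset.sum_range_succ, ← h2, ← h3]
        exact h1
    filter_upwards [Lp.coeFn_smul (n : ℝ)⁻¹ (birkhoffSum U _root_.id n hgL.toLp), hsum]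
      with ω h1 h2
    refine h1.trans ?_
    rw [Pi.smul_apply, h2, smul_eq_mul, dirAvg]
  have hconv := U.toContinuousLinearMap.tendsto_birkhoffAverage_orthogonalProjection
    U.norm_toContinuousLinearMap_le hgL.toLp
  obtain ⟨N, hN⟩ := Metric.cauchySeq_iff.1 hconv.cauchySeq ε hε
  refine ⟨N, fun n hn m hm => ?_⟩
  have h1 := (hN n hn m hm).le
  rw [dist_eq_norm, Lp.norm_def] at h1
  have h2 : (birkhoffAverage ℝ U _root_.id n hgL.toLp - birkhoffAverage ℝ U _root_.id m hgL.toLp :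
      Lp ℝ 2 P) =ᵐ[P] fun ω => dirAvg d e n g ω - dirAvg d e m g ω := by
    filter_upwards [Lp.coeFn_sub (birkhoffAverage ℝ U _root_.id n hgL.toLp : Lp ℝ 2 P)
      (birkhoffAverage ℝ U _root_.id m hgL.toLp), havg n, havg m] with ω a b c
    rw [a, Pi.sub_apply, b, c]
  have h3 : MemLp (fun ω => dirAvg d e n g ω - dirAvg d e m g ω) 2 P :=
    (memLp_congr_ae h2).1 (Lp.memLp _)
  refine (integral_abs_sub_le_sqrt h3).trans ?_
  rw [← eLpNorm_congr_ae h2]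
  exact h1

/-- Mean ergodic theorem in `L¹`. -/
lemma exists_dirAvg_limit (hP : StatErg d P) (e : Vert d) {f : EnvSp d → ℝ}
    (hf : Integrable f P) : ∃ G : EnvSp d → ℝ, Integrable G P ∧
      Tendsto (fun n => ∫ ω, |dirAvg d e n f ω - G ω| ∂P) atTop (𝓝 0) := by
  have := hP.prob
  have hi := fun n => integrable_dirAvg hP e n hf
  have hdist : ∀ n m, dist (hi n).toL1 (hi m).toL1 =
      ∫ ω, |dirAvg d e n f ω - dirAvg d e m f ω| ∂P := fun n m => by
    rw [dist_eq_norm, ← Integrable.toL1_sub, L1.norm_of_fun_eq_integral_norm]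
    rfl
  have hC : CauchySeq fun n => (hi n).toL1 := by
    refine Metric.cauchySeq_iff.2 fun ε hε => ?_
    obtain ⟨g, hg, hgi⟩ := hf.exists_boundedContinuous_integral_sub_le (by positivity : 0 < ε / 4)
    have hgb : IsBdd d g := ⟨‖g‖, fun ω => g.norm_coe_le_norm ω⟩
    obtain ⟨N, hN⟩ := dirAvg_cauchy_of_bdd hP e g.continuous.measurable hgb
      (by positivity : 0 < ε / 4)
    refine ⟨N, fun n hn m hm => ?_⟩
    rw [hdist]
    have hb : ∀ k, ∫ ω, |dirAvg d e k f ω - dirAvg d e k g ω| ∂P ≤ ε / 4 := fun k => by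
      simp_rw [← dirAvg_sub]
      exact (integral_abs_dirAvg_le hP e k (hf.sub hgi)).trans hg
    have hgk := fun k => integrable_dirAvg hP e k hgi
    have h1 : ∫ ω, |dirAvg d e n f ω - dirAvg d e m f ω| ∂P ≤
        ∫ ω, (|dirAvg d e n f ω - dirAvg d e n g ω| + |dirAvg d e n g ω - dirAvg d e m g ω| +
          |dirAvg d e m f ω - dirAvg d e m g ω|) ∂P := by
      refine integral_mono ((hi n).sub (hi m)).abs ((((hi n).sub (hgk n)).abs.add
        ((hgk n).sub (hgk m)).abs).add ((hi m).sub (hgk m)).abs) fun ω => ?_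
      have := abs_sub_le (dirAvg d e n f ω) (dirAvg d e n g ω) (dirAvg d e m f ω)
      have h2 := abs_sub_le (dirAvg d e n g ω) (dirAvg d e m g ω) (dirAvg d e m f ω)
      rw [abs_sub_comm (dirAvg d e m g ω)] at h2
      simp only
      linarith
    rw [integral_add, integral_add] at h1
    · linarith [hb n, hb m, hN n hn m hm]
    · exact ((hi n).sub (hgk n)).abs
    · exact ((hgk n).sub (hgk m)).abs
    · exact (((hi n).sub (hgk n)).abs).add ((hgk n).sub (hgk m)).abs
    · exact ((hi m).sub (hgk m)).abs
  obtain ⟨G, hG⟩ := cauchySeq_tendsto_of_complete hC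
  refine ⟨G, L1.integrable_coeFn G, ?_⟩
  rw [tendsto_iff_dist_tendsto_zero] at hG
  refine hG.congr fun n => ?_
  rw [dist_eq_norm, L1.norm_eq_integral_norm]
  refine integral_congr_ae ?_
  filter_upwards [Lp.coeFn_sub (hi n).toL1 G, (hi n).coeFn_toL1] with ω h1 h2
  rw [h1, Pi.sub_apply, h2, Real.norm_eq_abs]

end Ergodic

section Cocycles

variable {d : ℕ} {P : Measure (EnvSp d)}

/-- Integrable cocycles of mean zero over the translations. -/
structure IsCocycle (d : ℕ) (P : Measure (EnvSp d)) (Φ : Vert d → EnvSp d → ℝ) : Prop where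
  integrable : ∀ y, Integrable (Φ y) P
  add : ∀ x y, ∀ᵐ ω ∂P, Φ (x + y) ω = Φ x ω + Φ y (shift d x ω)
  mean : ∀ y, ∫ ω, Φ y ω ∂P = 0

variable {Φ : Vert d → EnvSp d → ℝ}

lemma integral_abs_shift (hP : StatErg d P) (x : Vert d) (f : EnvSp d → ℝ) :
    ∫ ω, |f (shift d x ω)| ∂P = ∫ ω, |f ω| ∂P :=
  integral_shift hP x fun ω => |f ω|

namespace IsCocycle

lemma zero (hΦ : IsCocycle d P Φ) : ∀ᵐ ω ∂P, Φ 0 ω = 0 := by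
  filter_upwards [hΦ.add 0 0] with ω h
  rw [shift_zero, add_zero] at h
  linarith

lemma integral_abs_add_le (hP : StatErg d P) (hΦ : IsCocycle d P Φ) (x y : Vert d) :
    ∫ ω, |Φ (x + y) ω| ∂P ≤ ∫ ω, |Φ x ω| ∂P + ∫ ω, |Φ y ω| ∂P := by
  rw [← integral_abs_shift hP x (Φ y), ← integral_add (hΦ.integrable x).abs
    (integrable_shift hP x (hΦ.integrable y)).abs]
  refine integral_mono_ae (hΦ.integrable _).abs ((hΦ.integrable x).abs.add
    (integrable_shift hP x (hΦ.integrable y)).abs) ?_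
  filter_upwards [hΦ.add x y] with ω h
  rw [h]
  exact abs_add_le _ _

lemma integral_abs_zero (hΦ : IsCocycle d P Φ) : ∫ ω, |Φ 0 ω| ∂P = 0 := by
  rw [integral_congr_ae (g := fun _ => 0) (hΦ.zero.mono fun ω h => by simp [h])]
  simp

lemma integral_abs_neg (hP : StatErg d P) (hΦ : IsCocycle d P Φ) (x : Vert d) :
    ∫ ω, |Φ (-x) ω| ∂P = ∫ ω, |Φ x ω| ∂P := by
  rw [← integral_abs_shift hP (-x) (Φ x)]
  refine integral_congr_ae ?_
  filter_upwards [hΦ.add (-x) x, hΦ.zero] with ω h h0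
  rw [neg_add_cancel, h0] at h
  rw [show Φ (-x) ω = -Φ x (shift d (-x) ω) by linarith, abs_neg]

lemma integral_abs_nsmul_le (hP : StatErg d P) (hΦ : IsCocycle d P Φ) (x : Vert d) (n : ℕ) :
    ∫ ω, |Φ (n • x) ω| ∂P ≤ n * ∫ ω, |Φ x ω| ∂P := by
  induction n with
  | zero => simp [hΦ.integral_abs_zero]
  | succ n ih =>
    rw [succ_nsmul]
    have := hΦ.integral_abs_add_le hP (n • x) x
    push_cast
    linarith

lemma integral_abs_zsmul (hP : StatErg d P) (hΦ : IsCocycle d P Φ) (x : Vert d) (n : ℤ) :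
    ∫ ω, |Φ (n • x) ω| ∂P = ∫ ω, |Φ (n.natAbs • x) ω| ∂P := by
  rcases Int.natAbs_eq n with h | h
  · conv_lhs => rw [h]
    rw [natCast_zsmul]
  · conv_lhs => rw [h]
    rw [neg_smul, hΦ.integral_abs_neg hP, natCast_zsmul]

lemma integral_abs_sum_le (hP : StatErg d P) (hΦ : IsCocycle d P Φ) {ι : Type*} (s : Finset ι)
    (x : ι → Vert d) :
    ∫ ω, |Φ (∑ i ∈ s, x i) ω| ∂P ≤ ∑ i ∈ s, ∫ ω, |Φ (x i) ω| ∂P := by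
  classical
  induction s using Finset.induction_on with
  | empty => simp [hΦ.integral_abs_zero]
  | insert a s ha ih =>
    rw [Finset.sum_insert ha, Finset.sum_insert ha]
    exact (hΦ.integral_abs_add_le hP _ _).trans (by gcongr)

lemma nsmul_eq_dirAvg (hΦ : IsCocycle d P Φ) (e : Vert d) {n : ℕ} (hn : 1 ≤ n) :
    ∀ᵐ ω ∂P, Φ (n • e) ω = n * dirAvg d e n (Φ e) ω := by
  have h : ∀ n : ℕ, ∀ᵐ ω ∂P, Φ (n • e) ω = ∑ t ∈ Finset.range n, Φ e (shift d (t • e) ω) := by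
    intro n
    induction n with
    | zero => simpa using hΦ.zero
    | succ n ih =>
      filter_upwards [ih, hΦ.add (n • e) e] with ω h1 h2
      rw [succ_nsmul, h2, h1, Finset.sum_range_succ]
  filter_upwards [h n] with ω h1
  have : (n : ℝ) ≠ 0 := by positivity
  rw [h1, dirAvg, mul_inv_cancel_left₀ this]

/-- Cocycles of mean zero are sublinear along every direction. -/
lemma tendsto_nsmul (hP : StatErg d P) (hΦ : IsCocycle d P Φ) (e : Vert d) :
    Tendsto (fun n : ℕ => (∫ ω, |Φ (n • e) ω| ∂P) / n) atTop (𝓝 0) := by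
  have := hP.prob
  obtain ⟨G, hG, hlim⟩ := exists_dirAvg_limit hP e (hΦ.integrable e)
  have hi := fun n => integrable_dirAvg hP e n (hΦ.integrable e)
  have hG0 : ∫ ω, G ω ∂P = 0 := by
    have h1 : ∀ n, ∫ ω, dirAvg d e n (Φ e) ω ∂P = 0 := fun n => by
      unfold dirAvg
      rw [integral_const_mul, integral_finsetSum _ fun _ _ =>
        integrable_shift hP _ (hΦ.integrable e)]
      simp_rw [integral_shift hP _ (Φ e), hΦ.mean]
      simp
    have h2 : ∀ n, |∫ ω, G ω ∂P| ≤ ∫ ω, |dirAvg d e n (Φ e) ω - G ω| ∂P := fun n => by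
      have := abs_integral_le_integral_abs (μ := P) (f := fun ω => dirAvg d e n (Φ e) ω - G ω)
      rwa [integral_sub (hi n) hG, h1, zero_sub, abs_neg] at this
    exact abs_nonpos_iff.1 (ge_of_tendsto' hlim h2)
  have hinv : ∀ x, ∀ᵐ ω ∂P, G (shift d x ω) = G ω := by
    intro x
    have h1 : ∀ n : ℕ, 1 ≤ n → ∫ ω, |G (shift d x ω) - G ω| ∂P ≤
        2 * ∫ ω, |dirAvg d e n (Φ e) ω - G ω| ∂P + 2 * (∫ ω, |Φ x ω| ∂P) / n := by
      intro n hn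
      have hn0 : (0 : ℝ) < n := by exact_mod_cast hn
      have i1 := integrable_shift hP x ((hi n).sub hG).abs
      have i2 := ((hi n).sub hG).abs
      have i3 := ((hΦ.integrable x).abs.add
        (integrable_shift hP (n • e) (hΦ.integrable x)).abs).div_const (n : ℝ)
      have h2 : ∫ ω, |G (shift d x ω) - G ω| ∂P ≤
          ∫ ω, (|dirAvg d e n (Φ e) (shift d x ω) - G (shift d x ω)| +
            |dirAvg d e n (Φ e) ω - G ω| + (|Φ x ω| + |Φ x (shift d (n • e) ω)|) / n) ∂P := by
        refine integral_mono_ae ((integrable_shift hP x hG).sub hG).abs ((i1.add i2).add i3) ?_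
        filter_upwards [hΦ.add x (n • e), hΦ.add (n • e) x, hΦ.nsmul_eq_dirAvg e hn,
          ae_shift hP x (hΦ.nsmul_eq_dirAvg e hn)] with ω a b c' c''
        rw [add_comm, b, c', c''] at a
        have h3 : dirAvg d e n (Φ e) (shift d x ω) - dirAvg d e n (Φ e) ω =
            (Φ x (shift d (n • e) ω) - Φ x ω) / n := by
          field_simp
          linarith
        have h4 : |(Φ x (shift d (n • e) ω) - Φ x ω) / n| ≤
            (|Φ x ω| + |Φ x (shift d (n • e) ω)|) / n := by
          rw [abs_div, abs_of_pos hn0]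
          gcongr
          linarith [abs_sub (Φ x (shift d (n • e) ω)) (Φ x ω)]
        rw [← h3] at h4
        have h5 := abs_sub_le (G (shift d x ω)) (dirAvg d e n (Φ e) (shift d x ω)) (G ω)
        have h6 := abs_sub_le (dirAvg d e n (Φ e) (shift d x ω)) (dirAvg d e n (Φ e) ω) (G ω)
        rw [abs_sub_comm (G (shift d x ω)) (dirAvg d e n (Φ e) (shift d x ω))] at h5
        linarith
      have e1 := integral_add (i1.add i2) i3
      have e2 := integral_add i1 i2
      simp only [Pi.add_apply, Pi.sub_apply] at e1 e2
      rw [e1, e2, integral_div, integral_add (hΦ.integrable x).abs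
        (integrable_shift hP (n • e) (hΦ.integrable x)).abs, integral_abs_shift hP _ (Φ x),
        integral_shift hP x fun ω => |dirAvg d e n (Φ e) ω - G ω|] at h2
      refine h2.trans_eq ?_
      ring
    have h2 : Tendsto (fun n : ℕ => 2 * ∫ ω, |dirAvg d e n (Φ e) ω - G ω| ∂P +
        2 * (∫ ω, |Φ x ω| ∂P) / n) atTop (𝓝 0) := by
      have := (hlim.const_mul 2).add
        (tendsto_const_div_atTop_nhds_zero_nat (2 * ∫ ω, |Φ x ω| ∂P))
      simpa using this
    have h3 : ∫ ω, |G (shift d x ω) - G ω| ∂P = 0 :=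
      le_antisymm (ge_of_tendsto h2 ((eventually_ge_atTop 1).mono h1))
        (integral_nonneg fun _ => abs_nonneg _)
    have h4 := (integral_eq_zero_iff_of_nonneg (fun _ => abs_nonneg _)
      ((integrable_shift hP x hG).sub hG).abs).1 h3
    filter_upwards [h4] with ω h
    exact sub_eq_zero.1 (abs_eq_zero.1 h)
  have hGz := ae_zero_of_invariant hP hG hinv hG0
  refine hlim.congr' ?_
  filter_upwards [eventually_ge_atTop 1] with n hn
  have hn0 : (0 : ℝ) < n := by exact_mod_cast hn
  rw [← integral_div]
  refine integral_congr_ae ?_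
  filter_upwards [hGz, hΦ.nsmul_eq_dirAvg e hn] with ω h1 h2
  rw [h1, h2, abs_mul, abs_of_pos hn0, Pi.zero_apply, sub_zero]
  field_simp

lemma sum_unitv (y : Vert d) : ∑ i, y i • unitv d i = y := by
  funext j
  simp [unitv, Finset.sum_apply]

/-- Uniform sublinearity of cocycles of mean zero. -/
lemma eventually_le (hP : StatErg d P) (hΦ : IsCocycle d P Φ) {ε : ℝ} (hε : 0 < ε) :
    ∀ᶠ n : ℕ in atTop, ∀ y ∈ box d (n : ℝ), ∫ ω, |Φ y ω| ∂P ≤ ε * n := by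
  have key : ∀ δ > 0, ∀ i, ∀ᶠ n : ℕ in atTop, ∀ m ≤ n,
      ∫ ω, |Φ (m • unitv d i) ω| ∂P ≤ δ * n := by
    intro δ hδ i
    obtain ⟨N, hN⟩ := eventually_atTop.1
      ((hΦ.tendsto_nsmul hP (unitv d i)).eventually (gt_mem_nhds hδ))
    have hlin : Tendsto (fun n : ℕ => δ * (n : ℝ)) atTop atTop :=
      tendsto_natCast_atTop_atTop.const_mul_atTop hδ
    filter_upwards [hlin.eventually_ge_atTop (N * ∫ ω, |Φ (unitv d i) ω| ∂P)] with n hn m hm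
    have hI : 0 ≤ ∫ ω, |Φ (unitv d i) ω| ∂P := integral_nonneg fun _ => abs_nonneg _
    rcases Nat.eq_zero_or_pos m with rfl | hm0
    · rw [zero_smul, hΦ.integral_abs_zero]
      positivity
    rcases le_total N m with h | h
    · have := (hN m h).le
      rw [div_le_iff₀ (by exact_mod_cast hm0)] at this
      refine this.trans ?_
      gcongr
    · refine (hΦ.integral_abs_nsmul_le hP _ m).trans (le_trans ?_ hn)
      gcongr
  have h1 : ∀ᶠ n : ℕ in atTop, ∀ i, ∀ m ≤ n,
      ∫ ω, |Φ (m • unitv d i) ω| ∂P ≤ (ε / (d + 1)) * n :=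
    eventually_all.2 fun i => key _ (by positivity) i
  filter_upwards [h1] with n hn y hy
  rw [mem_box] at hy
  calc ∫ ω, |Φ y ω| ∂P = ∫ ω, |Φ (∑ i, y i • unitv d i) ω| ∂P := by rw [sum_unitv]
    _ ≤ ∑ i, ∫ ω, |Φ (y i • unitv d i) ω| ∂P := hΦ.integral_abs_sum_le hP _ _
    _ ≤ ∑ i : Fin d, (ε / (d + 1)) * n := by
        refine Finset.sum_le_sum fun i _ => ?_
        rw [hΦ.integral_abs_zsmul hP]
        refine hn i _ ?_
        have := hy i
        rw [Int.abs_eq_natAbs] at this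
        exact_mod_cast this
    _ = (d / (d + 1)) * (ε * n) := by
        rw [Finset.sum_const, Finset.card_univ, Fintype.card_fin, nsmul_eq_mul]
        ring
    _ ≤ 1 * (ε * n) := by
        gcongr
        rw [div_le_one (by positivity)]
        linarith
    _ = ε * n := one_mul _

end IsCocycle

end Cocycles

section Weighted

variable {d : ℕ} {P : Measure (EnvSp d)} {w : EnvSp d → ℝ}

/-- The measure with density `w` with respect to `P`. -/
def wMeas (P : Measure (EnvSp d)) (w : EnvSp d → ℝ) : Measure (EnvSp d) :=
  P.withDensity fun ω => ENNReal.ofReal (w ω)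

lemma isFiniteMeasure_wMeas (hw : Integrable w P) : IsFiniteMeasure (wMeas P w) :=
  isFiniteMeasure_withDensity_ofReal hw.2

lemma integral_wMeas (hw : Measurable w) (h0 : ∀ ω, 0 ≤ w ω) (f : EnvSp d → ℝ) :
    ∫ ω, f ω ∂(wMeas P w) = ∫ ω, f ω * w ω ∂P := by
  rw [wMeas, integral_withDensity_eq_integral_toReal_smul hw.ennreal_ofReal
    (Eventually.of_forall fun _ => ENNReal.ofReal_lt_top)]
  refine integral_congr_ae (Eventually.of_forall fun ω => ?_)
  simp [ENNReal.toReal_ofReal (h0 ω), mul_comm]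

lemma integrable_wMeas_iff (hw : Measurable w) (h0 : ∀ ω, 0 ≤ w ω) {f : EnvSp d → ℝ} :
    Integrable f (wMeas P w) ↔ Integrable (fun ω => f ω * w ω) P := by
  rw [wMeas, integrable_withDensity_iff_integrable_smul' hw.ennreal_ofReal
    (Eventually.of_forall fun _ => ENNReal.ofReal_lt_top)]
  refine integrable_congr (Eventually.of_forall fun ω => ?_)
  simp [ENNReal.toReal_ofReal (h0 ω), mul_comm]

end Weighted

section Clamp

/-- Truncation of `t` to the interval `[-K, K]`. -/
def clamp (K t : ℝ) : ℝ := max (-K) (min t K)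

lemma continuous_clamp (K : ℝ) : Continuous (clamp K) := by
  unfold clamp; fun_prop

lemma abs_clamp_le {K : ℝ} (hK : 0 ≤ K) (t : ℝ) : |clamp K t| ≤ K :=
  abs_le.2 ⟨le_max_left _ _, max_le (by linarith) (min_le_right _ _)⟩

lemma clamp_eq {K t : ℝ} (h : |t| ≤ K) : clamp K t = t := by
  rw [clamp, min_eq_left (abs_le.1 h).2, max_eq_right (abs_le.1 h).1]

lemma abs_clamp_sub_le (K s t : ℝ) : |clamp K s - clamp K t| ≤ |s - t| :=
  (abs_max_sub_max_le_max _ _ _ _).trans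
    (max_le (by simp) ((abs_min_sub_min_le_max _ _ _ _).trans (by simp)))

/-- The error made by truncating an increment is only present at high level. -/
lemma sq_clamp_error_le {K a b g c M : ℝ} (hK : 0 < K) (hc : 0 ≤ c) (hM : 0 ≤ M)
    (hg : g = 4 * (c * b ^ 2)) :
    c * (b + clamp K (a - b) - clamp K a) ^ 2 ≤
      max (g - M) 0 + M * (2 / K * (|a| + |b|)) := by
  have hZ0 : 0 ≤ 2 / K * (|a| + |b|) := by positivity
  by_cases h : 2 / K * (|a| + |b|) ≤ 1
  · have h1 : |a| + |b| ≤ K / 2 := by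
      rw [div_mul_eq_mul_div, div_le_one hK] at h
      linarith
    have ha : |a| ≤ K := by linarith [abs_nonneg b, abs_nonneg a]
    have hab : |a - b| ≤ K := (abs_sub a b).trans (by linarith)
    rw [clamp_eq ha, clamp_eq hab]
    have : b + (a - b) - a = 0 := by ring
    rw [this]
    have := le_max_right (g - M) 0
    have := mul_nonneg hM hZ0
    nlinarith
  · have h1 : |b + clamp K (a - b) - clamp K a| ≤ 2 * |b| := by
      have h2 := abs_clamp_sub_le K (a - b) a
      rw [show a - b - a = -b by ring, abs_neg] at h2
      have h3 := abs_add_le b (clamp K (a - b) - clamp K a)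
      rw [add_sub_assoc]
      linarith
    have h2 : (b + clamp K (a - b) - clamp K a) ^ 2 ≤ 4 * b ^ 2 := by
      rw [← sq_abs, ← sq_abs b]
      nlinarith [abs_nonneg (b + clamp K (a - b) - clamp K a)]
    have h3 := mul_le_mul_of_nonneg_left h2 hc
    have h4 := le_max_left (g - M) 0
    have h5 : M * 1 ≤ M * (2 / K * (|a| + |b|)) := by gcongr; exact (not_le.1 h).le
    linarith

end Clamp

section Potential

variable {d : ℕ} {P : Measure (EnvSp d)} {Φ : Vert d → EnvSp d → ℝ}

lemma sq_avg_le {n : ℕ} (a : Vert d → ℝ) :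
    ((∑ y ∈ box d (n : ℝ), a y) / vol d n) ^ 2 ≤ (∑ y ∈ box d (n : ℝ), a y ^ 2) / vol d n := by
  have h := sq_sum_le_card_mul_sum_sq (s := box d (n : ℝ)) (f := a)
  have hv := vol_pos (d := d) n
  rw [div_pow, div_le_div_iff₀ (by positivity) hv]
  change _ ≤ vol d n * _ at h
  nlinarith

/-- The truncated block averages of a cocycle, an approximate potential. -/
def blockPot (d : ℕ) (Φ : Vert d → EnvSp d → ℝ) (n : ℕ) (K : ℝ) (ω : EnvSp d) : ℝ :=
  -((∑ y ∈ box d (n : ℝ), clamp K (Φ y ω)) / vol d n)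

lemma abs_blockPot_le (n : ℕ) {K : ℝ} (hK : 0 ≤ K) (ω : EnvSp d) : |blockPot d Φ n K ω| ≤ K := by
  rw [blockPot, abs_neg, abs_div, abs_of_pos (vol_pos n), div_le_iff₀ (vol_pos n)]
  refine (Finset.abs_sum_le_sum_abs _ _).trans
    ((Finset.sum_le_sum fun y _ => abs_clamp_le hK _).trans_eq ?_)
  rw [Finset.sum_const, nsmul_eq_mul, mul_comm]
  rfl

lemma aestronglyMeasurable_blockPot (hΦ : IsCocycle d P Φ) (n : ℕ) (K : ℝ) :
    AEStronglyMeasurable (blockPot d Φ n K) P := by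
  have : AEStronglyMeasurable (fun ω => ∑ y ∈ box d (n : ℝ), clamp K (Φ y ω)) P :=
    Finset.aestronglyMeasurable_fun_sum _ fun y _ =>
      (continuous_clamp K).comp_aestronglyMeasurable (hΦ.integrable y).1
  exact ((this.aemeasurable.div_const _).neg).aestronglyMeasurable

/-- The gradient of the approximate potential is close to the increments of the cocycle. -/
lemma blockPot_error (hP : StatErg d P) (hc : ∀ i, Integrable (edgeCnd d i) P)
    (hΦ : IsCocycle d P Φ)
    (hχ : ∀ i, Integrable (fun ω => edgeCnd d i ω * Φ (unitv d i) ω ^ 2) P)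
    (i : Fin d) {n : ℕ} (hn : 1 ≤ n) {ε ε' M : ℝ} (hε : 0 < ε) (hM : 0 ≤ M)
    (hsub : ∀ y ∈ box d ((n + 1 : ℕ) : ℝ), ∫ ω, |Φ y ω| ∂P ≤ ε' * (n + 1 : ℕ)) :
    ∫ ω, edgeCnd d i ω * (Φ (unitv d i) ω -
        (blockPot d Φ n (ε * n) (shift d (unitv d i) ω) - blockPot d Φ n (ε * n) ω)) ^ 2 ∂P ≤
      2 * (2 ^ (d + 1) * ε) ^ 2 * ∫ ω, edgeCnd d i ω ∂P +
      2 * ∫ ω, max (4 * (edgeCnd d i ω * Φ (unitv d i) ω ^ 2) - M) 0 ∂P + 16 * M * ε' / ε := by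
  have := hP.prob
  have hn0 : (0 : ℝ) < n := by exact_mod_cast hn
  set e := unitv d i
  set K := ε * n with hK
  have hK0 : 0 < K := by positivity
  set F : Vert d → EnvSp d → ℝ := fun y ω =>
    max (4 * (edgeCnd d i ω * Φ e ω ^ 2) - M) 0 + M * (2 / K * (|Φ (y + e) ω| + |Φ e ω|)) with hF
  have hFm : Integrable (fun ω => max (4 * (edgeCnd d i ω * Φ e ω ^ 2) - M) 0) P :=
    (((hχ i).const_mul 4).sub (integrable_const M)).sup (integrable_const 0)
  have hFi2 : ∀ y, Integrable (fun ω => M * (2 / K * (|Φ (y + e) ω| + |Φ e ω|))) P := fun y =>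
    (((hΦ.integrable (y + e)).abs.add (hΦ.integrable e).abs).const_mul _).const_mul _
  have hFi : ∀ y, Integrable (F y) P := fun y => hFm.add (hFi2 y)
  have hFint : ∀ y ∈ box d (n : ℝ), ∫ ω, F y ω ∂P ≤
      ∫ ω, max (4 * (edgeCnd d i ω * Φ e ω ^ 2) - M) 0 ∂P + 8 * M * ε' / ε := by
    intro y hy
    simp only [hF]
    rw [integral_add hFm (hFi2 y), integral_const_mul, integral_const_mul,
      integral_add (hΦ.integrable (y + e)).abs (hΦ.integrable e).abs]
    have h1 := hsub _ (add_mem_box hy (unitv_mem_box i))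
    have h2 := hsub _ (box_mono (Nat.succ_le_succ (Nat.zero_le n)) (unitv_mem_box i))
    have hε' : 0 ≤ ε' := by
      have h3 := (integral_nonneg fun ω => abs_nonneg (Φ e ω)).trans h2
      exact nonneg_of_mul_nonneg_left h3 (by positivity)
    have h3 : ε' * ((n + 1 : ℕ) : ℝ) ≤ ε' * (2 * n) := by
      gcongr
      push_cast
      have : (1 : ℝ) ≤ n := by exact_mod_cast hn
      linarith
    have h4 : M * (2 / K * (∫ ω, |Φ (y + e) ω| ∂P + ∫ ω, |Φ e ω| ∂P)) ≤
        M * (2 / K * (ε' * (2 * n) + ε' * (2 * n))) := by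
      gcongr
      exacts [h1.trans h3, h2.trans h3]
    have h5 : M * (2 / K * (ε' * (2 * n) + ε' * (2 * n))) = 8 * M * ε' / ε := by
      rw [hK]
      field_simp
      ring
    linarith
  have hpt : ∀ᵐ ω ∂P, edgeCnd d i ω * (Φ e ω -
      (blockPot d Φ n K (shift d e ω) - blockPot d Φ n K ω)) ^ 2 ≤
      2 * (2 ^ (d + 1) * ε) ^ 2 * edgeCnd d i ω + 2 * ((∑ y ∈ box d (n : ℝ), F y ω) / vol d n) := by
    have h0 : ∀ᵐ ω ∂P, ∀ y, Φ (e + y) ω = Φ e ω + Φ y (shift d e ω) := ae_all_iff.2 (hΦ.add e)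
    filter_upwards [h0] with ω h
    have hc0 := (edgeCnd_pos i ω).le
    have hv := vol_pos (d := d) n
    have hid : Φ e ω - (blockPot d Φ n K (shift d e ω) - blockPot d Φ n K ω) =
        (∑ y ∈ box d (n : ℝ), (Φ e ω + clamp K (Φ (y + e) ω - Φ e ω) - clamp K (Φ (y + e) ω))) /
          vol d n + (∑ y ∈ box d (n : ℝ), clamp K (Φ (y + e) ω) -
            ∑ y ∈ box d (n : ℝ), clamp K (Φ y ω)) / vol d n := by
      have h1 : ∀ y, Φ (y + e) ω - Φ e ω = Φ y (shift d e ω) := fun y => by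
        rw [add_comm y, h]; ring
      simp only [h1, blockPot]
      have h2 : ∑ _y ∈ box d (n : ℝ), Φ e ω = Φ e ω * vol d n := by
        rw [Finset.sum_const, nsmul_eq_mul, mul_comm]; rfl
      rw [Finset.sum_sub_distrib, Finset.sum_add_distrib, h2]
      field_simp
      ring
    rw [hid]
    set A := (∑ y ∈ box d (n : ℝ), (Φ e ω + clamp K (Φ (y + e) ω - Φ e ω) -
      clamp K (Φ (y + e) ω))) / vol d n
    set B := (∑ y ∈ box d (n : ℝ), clamp K (Φ (y + e) ω) -
            ∑ y ∈ box d (n : ℝ), clamp K (Φ y ω)) / vol d n with hB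
    have hB1 : |B| ≤ 2 ^ (d + 1) * ε := by
      rw [hB, abs_div, abs_of_pos hv, div_le_iff₀ hv]
      refine (abs_sum_box_shift_sub_le (unitv_mem_box i) (fun y => clamp K (Φ y ω)) K
        fun y => abs_clamp_le hK0.le _).trans ?_
      have := mul_le_mul_of_nonneg_left (vol_add_sub_le (d := d) hn hn)
        (by positivity : 0 ≤ 2 * K)
      refine this.trans_eq ?_
      rw [hK, pow_succ]
      push_cast
      field_simp
    have hB2 : B ^ 2 ≤ (2 ^ (d + 1) * ε) ^ 2 := sq_le_sq' (by linarith [abs_le.1 hB1])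
      (abs_le.1 hB1).2
    have hA : edgeCnd d i ω * A ^ 2 ≤ (∑ y ∈ box d (n : ℝ), F y ω) / vol d n := by
      refine (mul_le_mul_of_nonneg_left (sq_avg_le _) hc0).trans ?_
      rw [← mul_div_assoc, Finset.mul_sum]
      gcongr with y _
      exact sq_clamp_error_le hK0 hc0 hM rfl
    have h3 : (A + B) ^ 2 ≤ 2 * A ^ 2 + 2 * B ^ 2 := by nlinarith [sq_nonneg (A - B)]
    have h4 := mul_le_mul_of_nonneg_left h3 hc0
    have h5 := mul_le_mul_of_nonneg_left hB2 hc0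
    nlinarith
  have hFs : Integrable (fun ω => (∑ y ∈ box d (n : ℝ), F y ω) / vol d n) P :=
    (integrable_finsetSum _ fun y _ => hFi y).div_const _
  refine (integral_mono_of_nonneg (Eventually.of_forall fun ω =>
    mul_nonneg (edgeCnd_pos i ω).le (sq_nonneg _))
    (((hc i).const_mul _).add (hFs.const_mul 2)) hpt).trans ?_
  rw [integral_add' ((hc i).const_mul _) (hFs.const_mul 2), integral_const_mul, integral_const_mul,
    integral_div, integral_finsetSum _ fun y _ => hFi y]
  have h6 : (∑ y ∈ box d (n : ℝ), ∫ ω, F y ω ∂P) / vol d n ≤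
      ∫ ω, max (4 * (edgeCnd d i ω * Φ e ω ^ 2) - M) 0 ∂P + 8 * M * ε' / ε := by
    rw [div_le_iff₀ (vol_pos n)]
    refine (Finset.sum_le_sum hFint).trans_eq ?_
    rw [Finset.sum_const, nsmul_eq_mul, mul_comm]
    rfl
  have : 16 * M * ε' / ε = 2 * (8 * M * ε' / ε) := by ring
  linarith

/-- A bounded potential may be replaced by a continuous one. -/
lemma exists_continuous_potential (hP : StatErg d P) (hc : ∀ i, Integrable (edgeCnd d i) P)
    {f : EnvSp d → ℝ} (hf : AEStronglyMeasurable f P) {K : ℝ} (hK : ∀ ω, |f ω| ≤ K)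
    {δ : ℝ} (hδ : 0 < δ) :
    ∃ h : EnvSp d → ℝ, Continuous h ∧ IsBdd d h ∧ ∀ i,
      ∫ ω, edgeCnd d i ω * ((f (shift d (unitv d i) ω) - f ω) -
        (h (shift d (unitv d i) ω) - h ω)) ^ 2 ∂P ≤ δ := by
  have := hP.prob
  let w : EnvSp d → ℝ := fun ω =>
    ∑ i, (edgeCnd d i ω + edgeCnd d i (shift d (-unitv d i) ω))
  have hw0 : ∀ ω, 0 ≤ w ω := fun ω =>
    Finset.sum_nonneg fun i _ => add_nonneg (edgeCnd_pos i _).le (edgeCnd_pos i _).le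
  have hwm : Measurable w := Finset.measurable_sum _ fun i _ =>
    (continuous_edgeCnd i).measurable.add
      ((continuous_edgeCnd i).measurable.comp (measurable_shift _))
  have hwi : Integrable w P := integrable_finsetSum _ fun i _ =>
    (hc i).add (integrable_shift hP _ (hc i))
  have := isFiniteMeasure_wMeas hwi
  have hfL : MemLp f 2 (wMeas P w) := MemLp.of_bound
    (hf.mono_ac (withDensity_absolutelyContinuous _ _)) K
    (Eventually.of_forall fun ω => hK ω)
  obtain ⟨h, hh, hhb, hle⟩ := exists_bdd_continuous_approx hfL (by positivity : 0 < δ / 2)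
  refine ⟨h, hh, hhb, fun i => ?_⟩
  rw [integral_wMeas hwm hw0] at hle
  obtain ⟨K', hK'⟩ := hhb
  set u : EnvSp d → ℝ := fun ω => (f ω - h ω) ^ 2 with hu
  have hum : AEStronglyMeasurable u P :=
    (hf.sub hh.aestronglyMeasurable).pow 2
  have hub : ∀ ω, |u ω| ≤ (K + K') ^ 2 := fun ω => by
    rw [hu]
    simp only [abs_pow]
    have := (abs_sub (f ω) (h ω)).trans (add_le_add (hK ω) (hK' ω))
    gcongr
  have hint : ∀ {g : EnvSp d → ℝ}, Integrable g P → Integrable (fun ω => u ω * g ω) P :=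
    fun hg => hg.bdd_mul hum (Eventually.of_forall fun ω => hub ω)
  have i1 := hint (integrable_shift hP (-unitv d i) (hc i))
  have i2 := hint (hc i)
  have i3 := integrable_shift hP (unitv d i) i1
  simp only [shift_shift, neg_add_cancel, shift_zero] at i3
  have e1 := integral_shift hP (unitv d i)
    fun ω => u ω * edgeCnd d i (shift d (-unitv d i) ω)
  simp only [shift_shift, neg_add_cancel, shift_zero] at e1
  have h1 : ∫ ω, edgeCnd d i ω * ((f (shift d (unitv d i) ω) - f ω) -
        (h (shift d (unitv d i) ω) - h ω)) ^ 2 ∂P ≤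
      ∫ ω, (2 * (u (shift d (unitv d i) ω) * edgeCnd d i ω) + 2 * (u ω * edgeCnd d i ω)) ∂P := by
    refine integral_mono_of_nonneg (Eventually.of_forall fun ω =>
      mul_nonneg (edgeCnd_pos i ω).le (sq_nonneg _)) ((i3.const_mul 2).add (i2.const_mul 2))
      (Eventually.of_forall fun ω => ?_)
    simp only [hu]
    generalize f (shift d (unitv d i) ω) = a
    generalize h (shift d (unitv d i) ω) = b
    have h2 : (a - f ω - (b - h ω)) ^ 2 ≤ 2 * (a - b) ^ 2 + 2 * (f ω - h ω) ^ 2 := by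
      nlinarith [sq_nonneg ((a - b) + (f ω - h ω))]
    have := mul_le_mul_of_nonneg_left h2 (edgeCnd_pos i ω).le
    linarith
  rw [integral_add (i3.const_mul 2) (i2.const_mul 2), integral_const_mul, integral_const_mul,
    e1] at h1
  have h2 : ∫ ω, u ω * edgeCnd d i (shift d (-unitv d i) ω) ∂P + ∫ ω, u ω * edgeCnd d i ω ∂P ≤
      ∫ ω, u ω * w ω ∂P := by
    rw [← integral_add i1 i2]
    refine integral_mono (i1.add i2) (hint hwi) fun ω => ?_
    rw [← mul_add, add_comm]
    refine mul_le_mul_of_nonneg_left ?_ (sq_nonneg _)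
    exact Finset.single_le_sum (f := fun i => edgeCnd d i ω + edgeCnd d i (shift d (-unitv d i) ω))
      (fun i _ => add_nonneg (edgeCnd_pos i _).le (edgeCnd_pos i _).le) (Finset.mem_univ i)
  linarith

/-- Square integrable cocycles of mean zero are limits of gradients. -/
lemma IsCocycle.exists_potential (hP : StatErg d P) (hc : ∀ i, Integrable (edgeCnd d i) P)
    (hΦ : IsCocycle d P Φ)
    (hχ : ∀ i, Integrable (fun ω => edgeCnd d i ω * Φ (unitv d i) ω ^ 2) P)
    {δ : ℝ} (hδ : 0 < δ) :
    ∃ h : EnvSp d → ℝ, Continuous h ∧ IsBdd d h ∧ ∀ i,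
      ∫ ω, edgeCnd d i ω * (Φ (unitv d i) ω - (h (shift d (unitv d i) ω) - h ω)) ^ 2 ∂P ≤ δ := by
  have := hP.prob
  have hε : ∃ ε > 0, ∀ i, 2 * (2 ^ (d + 1) * ε) ^ 2 * ∫ ω, edgeCnd d i ω ∂P ≤ δ / 12 := by
    have h1 : ∀ i, ∀ᶠ ε : ℝ in 𝓝[>] 0,
        2 * (2 ^ (d + 1) * ε) ^ 2 * ∫ ω, edgeCnd d i ω ∂P < δ / 12 := by
      intro i
      have : Tendsto (fun ε : ℝ => 2 * (2 ^ (d + 1) * ε) ^ 2 * ∫ ω, edgeCnd d i ω ∂P) (𝓝 0)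
          (𝓝 (2 * (2 ^ (d + 1) * 0) ^ 2 * ∫ ω, edgeCnd d i ω ∂P)) := by
        apply Continuous.tendsto
        fun_prop
      simp only [mul_zero, zero_mul, ne_eq, OfNat.ofNat_ne_zero, not_false_eq_true, zero_pow]
        at this
      exact (this.mono_left nhdsWithin_le_nhds).eventually (gt_mem_nhds (by positivity))
    obtain ⟨ε, h2, h3⟩ := ((eventually_all.2 h1).and self_mem_nhdsWithin).exists
    exact ⟨ε, h3, fun i => (h2 i).le⟩
  obtain ⟨ε, hε0, hε⟩ := hε
  have hM : ∃ M : ℕ, ∀ i,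
      2 * ∫ ω, max (4 * (edgeCnd d i ω * Φ (unitv d i) ω ^ 2) - M) 0 ∂P ≤ δ / 12 := by
    have h1 : ∀ i, ∀ᶠ M : ℕ in atTop,
        2 * ∫ ω, max (4 * (edgeCnd d i ω * Φ (unitv d i) ω ^ 2) - M) 0 ∂P < δ / 12 := by
      intro i
      have h2 : Tendsto (fun M : ℕ =>
          ∫ ω, max (4 * (edgeCnd d i ω * Φ (unitv d i) ω ^ 2) - M) 0 ∂P) atTop
          (𝓝 (∫ _ω, 0 ∂P)) := by
        refine tendsto_integral_of_dominated_convergence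
          (fun ω => 4 * (edgeCnd d i ω * Φ (unitv d i) ω ^ 2)) (fun M => ?_)
          ((hχ i).const_mul 4) (fun M => Eventually.of_forall fun ω => ?_)
          (Eventually.of_forall fun ω => ?_)
        · exact ((((hχ i).const_mul 4).sub (integrable_const (M : ℝ))).sup (integrable_const 0)).1
        · have := mul_nonneg (edgeCnd_pos i ω).le (sq_nonneg (Φ (unitv d i) ω))
          rw [Real.norm_of_nonneg (le_max_right _ _)]
          exact max_le (by linarith [(Nat.cast_nonneg M : (0 : ℝ) ≤ M)]) (by linarith)
        · refine tendsto_const_nhds.congr' ?_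
          filter_upwards [eventually_ge_atTop ⌈4 * (edgeCnd d i ω * Φ (unitv d i) ω ^ 2)⌉₊] with M hM
          rw [max_eq_right]
          linarith [(Nat.le_ceil (4 * (edgeCnd d i ω * Φ (unitv d i) ω ^ 2))).trans
            (Nat.cast_le.2 hM)]
      have h3 := h2.const_mul 2
      rw [integral_zero, mul_zero] at h3
      exact h3.eventually (gt_mem_nhds (by positivity))
    obtain ⟨M, h2⟩ := (eventually_all.2 h1).exists
    exact ⟨M, fun i => (h2 i).le⟩
  obtain ⟨M, hM⟩ := hM
  have hε' : 0 < δ * ε / (192 * (M + 1)) := by positivity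
  obtain ⟨n, hsub, hn⟩ := (((tendsto_add_atTop_nat 1).eventually (hΦ.eventually_le hP hε')).and
    (eventually_ge_atTop 1)).exists
  have hb : ∀ i, _ := fun i => blockPot_error hP hc hΦ hχ i hn hε0 (Nat.cast_nonneg M) hsub
  have hK : (0 : ℝ) ≤ ε * n := by positivity
  have hlast : 16 * (M : ℝ) * (δ * ε / (192 * (M + 1))) / ε ≤ δ / 12 := by
    rw [div_le_iff₀ hε0]
    rw [mul_div_assoc', div_le_iff₀ (by positivity)]
    nlinarith [mul_pos hδ hε0]
  obtain ⟨h, hh, hhb, hle⟩ := exists_continuous_potential hP hc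
    (aestronglyMeasurable_blockPot hΦ n (ε * n)) (abs_blockPot_le n hK)
    (by positivity : 0 < δ / 4)
  refine ⟨h, hh, hhb, fun i => ?_⟩
  set f := blockPot d Φ n (ε * n) with hf
  have hfm : AEStronglyMeasurable f P := aestronglyMeasurable_blockPot hΦ n (ε * n)
  have hfb : ∀ ω, |f ω| ≤ ε * n := abs_blockPot_le n hK
  obtain ⟨K', hK'⟩ := hhb
  have hfs : AEStronglyMeasurable (fun ω => f (shift d (unitv d i) ω)) P :=
    hfm.comp_measurePreserving (hP.mp _)
  have hhs : AEStronglyMeasurable (fun ω => h (shift d (unitv d i) ω)) P :=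
    (hh.comp (continuous_shift _)).aestronglyMeasurable
  have hcm : AEStronglyMeasurable (edgeCnd d i) P := (hc i).1
  have i1 : Integrable (fun ω => edgeCnd d i ω * (Φ (unitv d i) ω -
      (f (shift d (unitv d i) ω) - f ω)) ^ 2) P := by
    refine (((hχ i).const_mul 2).add ((hc i).const_mul (2 * (2 * (ε * n)) ^ 2))).mono'
      (hcm.mul (((hΦ.integrable _).1.sub (hfs.sub hfm)).pow 2)) (Eventually.of_forall fun ω => ?_)
    rw [Real.norm_of_nonneg (mul_nonneg (edgeCnd_pos i ω).le (sq_nonneg _))]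
    have h1 : |f (shift d (unitv d i) ω) - f ω| ≤ 2 * (ε * n) :=
      (abs_sub _ _).trans (by linarith [hfb ω, hfb (shift d (unitv d i) ω)])
    have h2 := sq_le_sq' (abs_le.1 h1).1 (abs_le.1 h1).2
    have h3 : (Φ (unitv d i) ω - (f (shift d (unitv d i) ω) - f ω)) ^ 2 ≤
        2 * Φ (unitv d i) ω ^ 2 + 2 * (f (shift d (unitv d i) ω) - f ω) ^ 2 := by
      nlinarith [sq_nonneg (Φ (unitv d i) ω + (f (shift d (unitv d i) ω) - f ω))]
    have h4 := mul_le_mul_of_nonneg_left (h3.trans (add_le_add_right (mul_le_mul_of_nonneg_left h2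
      zero_le_two) _)) (edgeCnd_pos i ω).le
    simp only [Pi.add_apply]
    linarith
  have i2 : Integrable (fun ω => edgeCnd d i ω * ((f (shift d (unitv d i) ω) - f ω) -
        (h (shift d (unitv d i) ω) - h ω)) ^ 2) P := by
    refine ((hc i).const_mul ((2 * (ε * n) + 2 * K') ^ 2)).mono'
      (hcm.mul (((hfs.sub hfm).sub (hhs.sub hh.aestronglyMeasurable)).pow 2))
      (Eventually.of_forall fun ω => ?_)
    rw [Real.norm_of_nonneg (mul_nonneg (edgeCnd_pos i ω).le (sq_nonneg _)), mul_comm]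
    refine mul_le_mul_of_nonneg_right ?_ (edgeCnd_pos i ω).le
    have h1 : |f (shift d (unitv d i) ω) - f ω - (h (shift d (unitv d i) ω) - h ω)| ≤
        2 * (ε * n) + 2 * K' := by
      have a := abs_sub (f (shift d (unitv d i) ω) - f ω) (h (shift d (unitv d i) ω) - h ω)
      have b := abs_sub (f (shift d (unitv d i) ω)) (f ω)
      have c := abs_sub (h (shift d (unitv d i) ω)) (h ω)
      linarith [hfb ω, hfb (shift d (unitv d i) ω), hK' ω, hK' (shift d (unitv d i) ω)]
    exact sq_le_sq' (abs_le.1 h1).1 (abs_le.1 h1).2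
  have h1 : ∫ ω, edgeCnd d i ω * (Φ (unitv d i) ω - (h (shift d (unitv d i) ω) - h ω)) ^ 2 ∂P ≤
      ∫ ω, (2 * (edgeCnd d i ω * (Φ (unitv d i) ω - (f (shift d (unitv d i) ω) - f ω)) ^ 2) +
        2 * (edgeCnd d i ω * ((f (shift d (unitv d i) ω) - f ω) -
        (h (shift d (unitv d i) ω) - h ω)) ^ 2)) ∂P := by
    refine integral_mono_of_nonneg (Eventually.of_forall fun ω =>
      mul_nonneg (edgeCnd_pos i ω).le (sq_nonneg _)) ((i1.const_mul 2).add (i2.const_mul 2))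
      (Eventually.of_forall fun ω => ?_)
    simp only
    generalize f (shift d (unitv d i) ω) - f ω = a
    generalize h (shift d (unitv d i) ω) - h ω = b
    have h2 : (Φ (unitv d i) ω - b) ^ 2 ≤ 2 * (Φ (unitv d i) ω - a) ^ 2 + 2 * (a - b) ^ 2 := by
      nlinarith [sq_nonneg ((Φ (unitv d i) ω - a) - (a - b))]
    have := mul_le_mul_of_nonneg_left h2 (edgeCnd_pos i ω).le
    linarith
  rw [integral_add (i1.const_mul 2) (i2.const_mul 2), integral_const_mul, integral_const_mul] at h1
  linarith [hb i, hle i, hε i, hM i]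

end Potential

section Increments

variable {d : ℕ} {ω : EnvSp d} {g : Vert d → ℝ}

/-- The increments of `g` in direction `y`, tested against the translates of `φ`. -/
def incr (d : ℕ) (ω : EnvSp d) (g : Vert d → ℝ) (y : Vert d) (φ : EnvSp d → ℝ) : ℝ :=
  ∑' x, φ (shift d x ω) * (g (x + y) - g x)

lemma summable_mul_shift (hg : g.support.Finite) (a : Vert d → ℝ) (y : Vert d) :
    Summable fun x => a x * g (x + y) := by
  refine summable_of_hasFiniteSupport ((hg.preimage (add_left_injective y).injOn).subset ?_)
  intro x hx
  exact right_ne_zero_of_mul hx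

lemma summable_incr (hg : g.support.Finite) (a : Vert d → ℝ) (y : Vert d) :
    Summable fun x => a x * (g (x + y) - g x) := by
  have := (summable_mul_shift hg a y).sub (summable_mul_shift hg a 0)
  refine this.congr fun x => ?_
  rw [add_zero]
  ring

lemma incr_add_dir (hg : g.support.Finite) (y z : Vert d) (φ : EnvSp d → ℝ) :
    incr d ω g (y + z) φ = incr d ω g y φ + incr d ω g z fun ω' => φ (shift d (-y) ω') := by
  have h1 : (incr d ω g z fun ω' => φ (shift d (-y) ω')) =
      ∑' x, φ (shift d x ω) * (g (x + y + z) - g (x + y)) := by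
    unfold incr
    rw [← (Equiv.addRight y).tsum_eq]
    simp only [Equiv.coe_addRight, shift_shift]
    refine tsum_congr fun x => ?_
    rw [neg_add_eq_sub, add_sub_cancel_right]
  have h2 : Summable fun x => φ (shift d x ω) * (g (x + y + z) - g (x + y)) := by
    have := (summable_mul_shift hg (fun x => φ (shift d x ω)) (y + z)).sub
      (summable_mul_shift hg (fun x => φ (shift d x ω)) y)
    refine this.congr fun x => ?_
    rw [add_assoc]
    ring
  rw [h1, incr, incr, ← (summable_incr hg _ y).tsum_add h2]
  refine tsum_congr fun x => ?_
  rw [← add_assoc]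
  ring

lemma incr_add (hg : g.support.Finite) (y : Vert d) (φ ψ : EnvSp d → ℝ) :
    (incr d ω g y fun ω' => φ ω' + ψ ω') = incr d ω g y φ + incr d ω g y ψ := by
  rw [incr, incr, incr, ← (summable_incr hg _ y).tsum_add (summable_incr hg _ y)]
  exact tsum_congr fun x => by ring

lemma incr_smul (y : Vert d) (t : ℝ) (φ : EnvSp d → ℝ) :
    (incr d ω g y fun ω' => t * φ ω') = t * incr d ω g y φ := by
  rw [incr, incr, ← tsum_mul_left]
  exact tsum_congr fun x => by ring

lemma incr_zero (φ : EnvSp d → ℝ) : incr d ω g 0 φ = 0 := by simp [incr]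

lemma incr_one (hg : g.support.Finite) (y : Vert d) : incr d ω g y (fun _ => 1) = 0 := by
  have h1 := summable_mul_shift hg (fun _ => 1) y
  have h2 := summable_mul_shift hg (fun _ => 1) 0
  simp only [one_mul, add_zero] at h1 h2
  simp only [incr, one_mul]
  rw [h1.tsum_sub h2, ← (Equiv.addRight y).tsum_eq g]
  simp

/-- Increments of a function supported in `Λ_r` live in `Λ_{r+1}`. -/
lemma incr_unitv_eq {r : ℕ} (hg : ∀ x ∉ box d (r : ℝ), g x = 0) (i : Fin d) (φ : EnvSp d → ℝ) :
    incr d ω g (unitv d i) φ =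
      ∑ x ∈ box d ((r + 1 : ℕ) : ℝ), φ (shift d x ω) * (g (x + unitv d i) - g x) := by
  refine tsum_eq_sum fun x hx => ?_
  rw [hg x fun h => hx (box_mono (Nat.le_succ r) h), hg (x + unitv d i) fun h => hx ?_]
  · ring
  · simpa using add_mem_box h (neg_mem_box (unitv_mem_box i))

lemma finite_support_of_box {r : ℕ} (hg : ∀ x ∉ box d (r : ℝ), g x = 0) : g.support.Finite :=
  (box d (r : ℝ)).finite_toSet.subset fun x hx => by
    by_contra h
    exact hx (hg x h)

lemma sq_incr_unitv_le {r : ℕ} (hg : ∀ x ∉ box d (r : ℝ), g x = 0) (i : Fin d)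
    (φ : EnvSp d → ℝ) :
    incr d ω g (unitv d i) φ ^ 2 ≤
      (∑ x ∈ box d ((r + 1 : ℕ) : ℝ), φ (shift d x ω) ^ 2 * (edgeCnd d i (shift d x ω))⁻¹) *
      ∑ x ∈ box d ((r + 1 : ℕ) : ℝ), edgeCnd d i (shift d x ω) * (g (x + unitv d i) - g x) ^ 2 := by
  rw [incr_unitv_eq hg]
  refine Finset.sum_sq_le_sum_mul_sum_of_sq_le_mul _ (fun x _ => ?_) (fun x _ => ?_)
    fun x _ => ?_
  · exact mul_nonneg (sq_nonneg _) (inv_nonneg.2 (edgeCnd_pos i _).le)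
  · exact mul_nonneg (edgeCnd_pos i _).le (sq_nonneg _)
  · have := (edgeCnd_pos i (shift d x ω)).ne'
    refine le_of_eq ?_
    field_simp

end Increments

section Limits

variable {d : ℕ} {ω : EnvSp d} {P : Measure (EnvSp d)}

lemma integrable_ae_zero [IsFiniteMeasure P] {f : EnvSp d → ℝ} (hf : Integrable f P)
    (h : ∀ φ : EnvSp d → ℝ, Continuous φ → IsBdd d φ → ∫ ω', φ ω' * f ω' ∂P = 0) :
    f =ᵐ[P] 0 := by
  have hpos : Integrable (fun ω' => max (f ω') 0) P := hf.sup (integrable_zero _ _ _)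
  have hneg : Integrable (fun ω' => max (-f ω') 0) P := hf.neg.sup (integrable_zero _ _ _)
  have := isFiniteMeasure_wMeas hpos
  have := isFiniteMeasure_wMeas hneg
  have hint : ∀ {u : EnvSp d → ℝ}, Integrable u P → (∀ ω', 0 ≤ u ω') → ∀ φ : EnvSp d → ℝ,
      ∫ ω', φ ω' ∂(wMeas P u) = ∫ ω', φ ω' * u ω' ∂P := by
    intro u hu hu0 φ
    rw [wMeas, integral_withDensity_eq_integral_toReal_smul₀ hu.1.aemeasurable.ennreal_ofReal
      (Eventually.of_forall fun _ => ENNReal.ofReal_lt_top)]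
    refine integral_congr_ae (Eventually.of_forall fun ω' => ?_)
    simp [ENNReal.toReal_ofReal (hu0 ω'), mul_comm]
  have hm : wMeas P (fun ω' => max (f ω') 0) = wMeas P (fun ω' => max (-f ω') 0) := by
    refine ext_of_forall_integral_eq_of_IsFiniteMeasure fun φ => ?_
    have hφb : IsBdd d φ := ⟨‖φ‖, φ.norm_coe_le_norm⟩
    rw [hint hpos fun _ => le_max_right _ _, hint hneg fun _ => le_max_right _ _, ← sub_eq_zero,
      ← integral_sub (hφb.integrable_mul φ.continuous.measurable hpos)
        (hφb.integrable_mul φ.continuous.measurable hneg)]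
    refine Eq.trans ?_ (h φ φ.continuous hφb)
    refine integral_congr_ae (Eventually.of_forall fun ω' => ?_)
    simp only
    rw [← mul_sub]
    congr 1
    rcases le_total (f ω') 0 with h | h
    · rw [max_eq_right h, max_eq_left (by linarith)]; ring
    · rw [max_eq_left h, max_eq_right (by linarith)]; ring
  rw [wMeas, wMeas, withDensity_eq_iff_of_sigmaFinite hpos.1.aemeasurable.ennreal_ofReal
    hneg.1.aemeasurable.ennreal_ofReal] at hm
  filter_upwards [hm] with ω' h1
  rw [ENNReal.ofReal_eq_ofReal_iff (le_max_right _ _) (le_max_right _ _)] at h1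
  simp only [Pi.zero_apply]
  rcases le_total (f ω') 0 with h | h
  · rw [max_eq_right h, max_eq_left (by linarith)] at h1; linarith
  · rw [max_eq_left h, max_eq_right (by linarith)] at h1; linarith

/-- `F` is the limit along `U` of the increments of `h` in direction `y`. -/
structure Rep (d : ℕ) (ω : EnvSp d) (P : Measure (EnvSp d)) (U : Ultrafilter ℕ)
    (h : ℕ → Vert d → ℝ) (y : Vert d) (F : EnvSp d → ℝ) : Prop where
  integrable : Integrable F P
  tendsto : ∀ φ : EnvSp d → ℝ, Continuous φ → IsBdd d φ →
    Tendsto (fun r => incr d ω (h r) y φ / vol d r) U (𝓝 (∫ ω', φ ω' * F ω' ∂P))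

variable {U : Ultrafilter ℕ} {h : ℕ → Vert d → ℝ} {y z : Vert d} {F G : EnvSp d → ℝ}

lemma Rep.add (hP : StatErg d P) (hs : ∀ r : ℕ, ∀ x ∉ box d (r : ℝ), h r x = 0)
    (hF : Rep d ω P U h y F) (hG : Rep d ω P U h z G) :
    Rep d ω P U h (y + z) fun ω' => F ω' + G (shift d y ω') := by
  refine ⟨hF.integrable.add (integrable_shift hP y hG.integrable), fun φ hφ hφb => ?_⟩
  have h1 := (hF.tendsto φ hφ hφb).add
    (hG.tendsto _ (hφ.comp (continuous_shift (-y))) (hφb.comp (-y)))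
  have h2 := integral_shift hP y fun ω' => φ (shift d (-y) ω') * G ω'
  simp only [shift_shift, neg_add_cancel, shift_zero] at h2
  have h3 : ∫ ω', φ ω' * (F ω' + G (shift d y ω')) ∂P =
      ∫ ω', φ ω' * F ω' ∂P + ∫ ω', φ (shift d (-y) ω') * G ω' ∂P := by
    rw [← h2, ← integral_add (hφb.integrable_mul hφ.measurable hF.integrable)
      (hφb.integrable_mul hφ.measurable (integrable_shift hP y hG.integrable))]
    simp only [mul_add]
  rw [h3]
  refine h1.congr fun r => ?_
  rw [incr_add_dir (finite_support_of_box (hs r)), add_div]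
  rfl

lemma Rep.zero : Rep d ω P U h 0 fun _ => 0 := by
  refine ⟨integrable_zero _ _ _, fun φ _ _ => ?_⟩
  simp only [incr_zero, zero_div, mul_zero, integral_zero]
  exact tendsto_const_nhds

lemma Rep.neg (hP : StatErg d P) (hs : ∀ r : ℕ, ∀ x ∉ box d (r : ℝ), h r x = 0)
    (hF : Rep d ω P U h y F) : Rep d ω P U h (-y) fun ω' => -F (shift d (-y) ω') := by
  refine ⟨(integrable_shift hP (-y) hF.integrable).neg, fun φ hφ hφb => ?_⟩
  have h1 := (hF.tendsto _ (hφ.comp (continuous_shift y)) (hφb.comp y)).neg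
  have h2 := integral_shift hP (-y) fun ω' => φ (shift d y ω') * F ω'
  simp only [shift_shift, add_neg_cancel, shift_zero] at h2
  simp only [mul_neg, integral_neg]
  rw [h2]
  refine h1.congr fun r => ?_
  have h3 := incr_add_dir (ω := ω) (finite_support_of_box (hs r)) (-y) y φ
  rw [neg_add_cancel, incr_zero, neg_neg] at h3
  simp only [Function.comp_def]
  rw [← neg_div]
  congr 1
  linarith

lemma Rep.ae_eq [IsFiniteMeasure P] (hF : Rep d ω P U h y F) (hG : Rep d ω P U h y G) :
    F =ᵐ[P] G := by
  have := integrable_ae_zero (hF.integrable.sub hG.integrable) fun φ hφ hφb => by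
    have h1 := tendsto_nhds_unique (hF.tendsto φ hφ hφb) (hG.tendsto φ hφ hφb)
    simp only [Pi.sub_apply, mul_sub]
    rw [integral_sub (hφb.integrable_mul hφ.measurable hF.integrable)
      (hφb.integrable_mul hφ.measurable hG.integrable), h1, sub_self]
  filter_upwards [this] with ω' h
  exact sub_eq_zero.1 h

/-- The limits of the increments along the coordinate directions. -/
lemma exists_rep_unitv (hR : Regular d ω P) (hU : (U : Filter ℕ) ≤ atTop)
    (hs : ∀ r : ℕ, ∀ x ∉ box d (r : ℝ), h r x = 0) (i : Fin d) {C : ℝ}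
    (hE : ∀ᶠ r : ℕ in atTop, ∑ x ∈ box d ((r + 1 : ℕ) : ℝ),
      edgeCnd d i (shift d x ω) * (h r (x + unitv d i) - h r x) ^ 2 ≤ C * vol d r) :
    ∃ F, Rep d ω P U h (unitv d i) F ∧ Integrable (fun ω' => edgeCnd d i ω' * F ω' ^ 2) P := by
  have := hR.prob
  set w : EnvSp d → ℝ := fun ω' => (edgeCnd d i ω')⁻¹ with hw
  have hwm : Measurable w := (continuous_edgeCnd_inv i).measurable
  have hw0 : ∀ ω', 0 ≤ w ω' := fun ω' => inv_nonneg.2 (edgeCnd_pos i ω').le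
  have := isFiniteMeasure_wMeas (hR.integrable_inv i)
  set D : ℕ → (EnvSp d → ℝ) → ℝ := fun r φ => incr d ω (h r) (unitv d i) φ / vol d r with hD
  have hC0 : 0 ≤ C := by
    obtain ⟨r, hr⟩ := hE.exists
    exact nonneg_of_mul_nonneg_left ((Finset.sum_nonneg fun x _ =>
      mul_nonneg (edgeCnd_pos i _).le (sq_nonneg _)).trans hr) (vol_pos r)
  have hA : ∀ φ : EnvSp d → ℝ, Continuous φ → IsBdd d φ → Tendsto (fun r : ℕ => C *
      ((∑ x ∈ box d ((r + 1 : ℕ) : ℝ), φ (shift d x ω) ^ 2 * w (shift d x ω)) / vol d r)) U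
      (𝓝 (C * ∫ ω', φ ω' ^ 2 * w ω' ∂P)) := by
    intro φ hφ hφb
    have h2 : IsBdd d fun ω' => φ ω' ^ 2 := by simpa [pow_two] using hφb.mul hφb
    exact (((hR.avg_div i _ (hφ.pow 2) h2).add 1).mono_left hU).const_mul C
  have hDle : ∀ φ : EnvSp d → ℝ, ∀ᶠ r : ℕ in (U : Filter ℕ), D r φ ^ 2 ≤ C *
      ((∑ x ∈ box d ((r + 1 : ℕ) : ℝ), φ (shift d x ω) ^ 2 * w (shift d x ω)) / vol d r) := by
    intro φ
    filter_upwards [hE.filter_mono hU] with r hr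
    have hv := vol_pos (d := d) r
    simp only [hD]
    rw [div_pow, div_le_iff₀ (by positivity)]
    refine (sq_incr_unitv_le (hs r) i φ).trans ?_
    have h3 : 0 ≤ ∑ x ∈ box d ((r + 1 : ℕ) : ℝ), φ (shift d x ω) ^ 2 *
        (edgeCnd d i (shift d x ω))⁻¹ :=
      Finset.sum_nonneg fun x _ => mul_nonneg (sq_nonneg _) (hw0 _)
    refine (mul_le_mul_of_nonneg_left hr h3).trans_eq ?_
    simp only [hw]
    field_simp
  have hlim : ∀ φ : EnvSp d → ℝ, Continuous φ → IsBdd d φ → ∃ L, Tendsto (fun r => D r φ) U (𝓝 L) := by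
    intro φ hφ hφb
    set B := C * (∫ ω', φ ω' ^ 2 * w ω' ∂P) + 1
    have h1 : ∀ᶠ r : ℕ in (U : Filter ℕ), D r φ ∈ Set.Icc (-√B) (√B) := by
      filter_upwards [hDle φ, (hA φ hφ hφb).eventually (gt_mem_nhds (lt_add_one _))] with r a b
      exact abs_le.1 (Real.abs_le_sqrt (a.trans b.le))
    obtain ⟨L, -, hL⟩ := (isCompact_Icc (a := -√B) (b := √B)).ultrafilter_le_nhds
      (U.map fun r => D r φ) (le_principal_iff.2 h1)
    exact ⟨L, hL⟩
  choose! S hS using hlim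
  obtain ⟨Y, hY, hSY⟩ := exists_riesz (μ := wMeas P w) (S := S) (C := C)
    (fun φ ψ hφ hφb hψ hψb => by
      refine tendsto_nhds_unique (hS _ (hφ.add hψ) (hφb.add hψb))
        (((hS φ hφ hφb).add (hS ψ hψ hψb)).congr fun r => ?_)
      simp only [hD]
      rw [incr_add (finite_support_of_box (hs r)), add_div])
    (fun t φ hφ hφb => by
      have htb : IsBdd d fun ω' => t * φ ω' := IsBdd.mul ⟨|t|, fun _ => le_rfl⟩ hφb
      refine tendsto_nhds_unique (hS _ (hφ.const_mul t) htb)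
        (((hS φ hφ hφb).const_mul t).congr fun r => ?_)
      simp only [hD]
      rw [incr_smul, mul_div_assoc])
    (fun φ hφ hφb => by
      rw [integral_wMeas hwm hw0]
      exact le_of_tendsto_of_tendsto ((hS φ hφ hφb).pow 2) (hA φ hφ hφb) (hDle φ))
  refine ⟨fun ω' => Y ω' * w ω', ⟨?_, fun φ hφ hφb => ?_⟩, ?_⟩
  · exact (integrable_wMeas_iff hwm hw0).1 (hY.integrable (by norm_num))
  · have h1 := hS φ hφ hφb
    rw [hSY φ hφ hφb, integral_wMeas hwm hw0] at h1
    simpa only [mul_assoc] using h1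
  · have h1 := (integrable_wMeas_iff hwm hw0).1 hY.integrable_sq
    refine h1.congr (Eventually.of_forall fun ω' => ?_)
    have := (edgeCnd_pos i ω').ne'
    simp only [hw]
    field_simp

/-- The increments of functions of bounded energy converge to a cocycle. -/
lemma exists_limit_cocycle (hP : StatErg d P) (hR : Regular d ω P) (hU : (U : Filter ℕ) ≤ atTop)
    (hs : ∀ r : ℕ, ∀ x ∉ box d (r : ℝ), h r x = 0) {C : ℝ}
    (hE : ∀ i, ∀ᶠ r : ℕ in atTop, ∑ x ∈ box d ((r + 1 : ℕ) : ℝ),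
      edgeCnd d i (shift d x ω) * (h r (x + unitv d i) - h r x) ^ 2 ≤ C * vol d r) :
    ∃ Φ, IsCocycle d P Φ ∧ (∀ y, Rep d ω P U h y (Φ y)) ∧
      ∀ i, Integrable (fun ω' => edgeCnd d i ω' * Φ (unitv d i) ω' ^ 2) P := by
  have := hR.prob
  choose χ hχ hχi using fun i => exists_rep_unitv hR hU hs i (hE i)
  let S : AddSubgroup (Vert d) :=
    { carrier := {y | ∃ F, Rep d ω P U h y F}
      add_mem' := fun ⟨_, hF⟩ ⟨_, hG⟩ => ⟨_, hF.add hP hs hG⟩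
      zero_mem' := ⟨_, Rep.zero⟩
      neg_mem' := fun ⟨_, hF⟩ => ⟨_, hF.neg hP hs⟩ }
  have hall : ∀ y, ∃ F, Rep d ω P U h y F := fun y => by
    have : ∑ i, y i • unitv d i ∈ S :=
      S.sum_mem fun i _ => S.zsmul_mem (show unitv d i ∈ S from ⟨_, hχ i⟩) _
    rwa [IsCocycle.sum_unitv] at this
  choose Φ hΦ using hall
  refine ⟨Φ, ⟨fun y => (hΦ y).integrable, fun x y => ?_, fun y => ?_⟩, hΦ, fun i => ?_⟩
  · exact (hΦ (x + y)).ae_eq ((hΦ x).add hP hs (hΦ y))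
  · have h1 := (hΦ y).tendsto (fun _ => 1) continuous_const ⟨1, fun _ => by simp⟩
    simp only [incr_one (finite_support_of_box (hs _)), zero_div, one_mul] at h1
    exact tendsto_nhds_unique h1 tendsto_const_nhds
  · refine (hχi i).congr ?_
    filter_upwards [(hΦ (unitv d i)).ae_eq (hχ i)] with ω' h1
    rw [h1]

end Limits

section Energies

variable {d : ℕ} {ω : EnvSp d} {P : Measure (EnvSp d)} {v : EnvSp d → Fin d → ℝ}

/-- The energy of `v∘τ(ω) - ∇g` over all edges based in `Λ_{r+1}`. -/
def boxEnergy (d : ℕ) (ω : EnvSp d) (v : EnvSp d → Fin d → ℝ) (r : ℕ) (g : Vert d → ℝ) : ℝ :=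
  ∑ i, ∑ x ∈ box d ((r + 1 : ℕ) : ℝ),
    edgeCnd d i (shift d x ω) * (v (shift d x ω) i - (g (x + unitv d i) - g x)) ^ 2

/-- The total conductance of the edges based in `Λ_n`. -/
def totCnd (d : ℕ) (ω : EnvSp d) (n : ℕ) : ℝ :=
  ∑ i, ∑ x ∈ box d (n : ℝ), edgeCnd d i (shift d x ω)

/-- The quantity minimized in the Dirichlet energy of `Λ_r`. -/
def latEnergy (d : ℕ) (ω : EnvSp d) (v : EnvSp d → Fin d → ℝ) (r : ℕ) (g : Vert d → ℝ) : ℝ :=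
  einner d ω (box d (r : ℝ)) (fun x i => efield d v ω x i - dgradE d g x i)
    (fun x i => efield d v ω x i - dgradE d g x i)

lemma latEnergy_nonneg (r : ℕ) (g : Vert d → ℝ) : 0 ≤ latEnergy d ω v r g :=
  Finset.sum_nonneg fun e _ => mul_nonneg (mul_self_nonneg _) (ω.2 e).le

lemma boxEnergy_eq_sum_edges (r : ℕ) (g : Vert d → ℝ) :
    boxEnergy d ω v r g = ∑ e ∈ box d ((r + 1 : ℕ) : ℝ) ×ˢ Finset.univ,
      (efield d v ω e.1 e.2 - dgradE d g e.1 e.2) *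
        (efield d v ω e.1 e.2 - dgradE d g e.1 e.2) * ω.1 e := by
  rw [Finset.sum_product_right, boxEnergy]
  refine Finset.sum_congr rfl fun i _ => Finset.sum_congr rfl fun x _ => ?_
  rw [edgeCnd_shift, efield, dgradE]
  ring

lemma totCnd_eq_sum_edges (n : ℕ) :
    totCnd d ω n = ∑ e ∈ box d (n : ℝ) ×ˢ Finset.univ, ω.1 e := by
  rw [Finset.sum_product_right, totCnd]
  simp only [edgeCnd_shift]

lemma totCnd_nonneg (n : ℕ) : 0 ≤ totCnd d ω n :=
  Finset.sum_nonneg fun _ _ => Finset.sum_nonneg fun _ _ => (edgeCnd_pos _ _).le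

lemma latEnergy_le_boxEnergy (r : ℕ) (g : Vert d → ℝ) :
    latEnergy d ω v r g ≤ boxEnergy d ω v r g := by
  rw [boxEnergy_eq_sum_edges]
  exact Finset.sum_le_sum_of_subset_of_nonneg (edgesIn_subset r)
    fun e _ _ => mul_nonneg (mul_self_nonneg _) (ω.2 e).le

/-- The edges based in `Λ_{r+1}` that do not touch `Λ_r` carry little energy. -/
lemma boxEnergy_le_latEnergy {M : ℝ} (hM : ∀ ω' i, |v ω' i| ≤ M) {r : ℕ} {g : Vert d → ℝ}
    (hg : ∀ x ∉ box d (r : ℝ), g x = 0) :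
    boxEnergy d ω v r g ≤
      latEnergy d ω v r g + M ^ 2 * (totCnd d ω (r + 1) - totCnd d ω r) := by
  classical
  have hsub : box d (r : ℝ) ×ˢ Finset.univ ⊆ edgesIn d (box d (r : ℝ)) := fun e he =>
    mem_edgesIn.2 (Or.inl (Finset.mem_product.1 he).1)
  have hT : totCnd d ω (r + 1) - totCnd d ω r =
      ∑ e ∈ (box d ((r + 1 : ℕ) : ℝ) ×ˢ Finset.univ) \ (box d (r : ℝ) ×ˢ Finset.univ), ω.1 e := by
    rw [totCnd_eq_sum_edges, totCnd_eq_sum_edges,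
      ← Finset.sum_sdiff (hsub.trans (edgesIn_subset r)), add_sub_cancel_right]
  rw [boxEnergy_eq_sum_edges, ← Finset.sum_sdiff (edgesIn_subset r), add_comm, latEnergy, einner,
    hT, Finset.mul_sum]
  gcongr
  refine (Finset.sum_le_sum fun e he => ?_).trans (Finset.sum_le_sum_of_subset_of_nonneg
    (Finset.sdiff_subset_sdiff le_rfl hsub) fun e _ _ => mul_nonneg (sq_nonneg M) (ω.2 e).le)
  have h1 := (Finset.mem_sdiff.1 he).2
  rw [mem_edgesIn, not_or] at h1
  rw [efield, dgradE, hg _ h1.1, hg _ h1.2, sub_zero, sub_zero, ← pow_two]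
  exact mul_le_mul_of_nonneg_right (sq_le_sq' (abs_le.1 (hM _ _)).1 (abs_le.1 (hM _ _)).2)
    (ω.2 e).le

lemma boxEnergy_zero_le {M : ℝ} (hM : ∀ ω' i, |v ω' i| ≤ M) (r : ℕ) :
    boxEnergy d ω v r 0 ≤ M ^ 2 * totCnd d ω (r + 1) := by
  rw [boxEnergy, totCnd, Finset.mul_sum]
  refine Finset.sum_le_sum fun i _ => ?_
  rw [Finset.mul_sum]
  refine Finset.sum_le_sum fun x _ => ?_
  rw [mul_comm]
  refine mul_le_mul_of_nonneg_right ?_ (edgeCnd_pos i _).le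
  simpa using sq_le_sq' (abs_le.1 (hM (shift d x ω) i)).1 (abs_le.1 (hM (shift d x ω) i)).2

lemma sum_grad_sq_le (r : ℕ) (g : Vert d → ℝ) (i : Fin d) :
    ∑ x ∈ box d ((r + 1 : ℕ) : ℝ), edgeCnd d i (shift d x ω) * (g (x + unitv d i) - g x) ^ 2 ≤
      2 * boxEnergy d ω v r g + 2 * boxEnergy d ω v r 0 := by
  have h1 : ∀ j : Fin d, 0 ≤ ∑ x ∈ box d ((r + 1 : ℕ) : ℝ),
      edgeCnd d j (shift d x ω) * (g (x + unitv d j) - g x) ^ 2 := fun j =>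
    Finset.sum_nonneg fun x _ => mul_nonneg (edgeCnd_pos j _).le (sq_nonneg _)
  refine (Finset.single_le_sum (f := fun j => ∑ x ∈ box d ((r + 1 : ℕ) : ℝ),
      edgeCnd d j (shift d x ω) * (g (x + unitv d j) - g x) ^ 2)
      (fun j _ => h1 j) (Finset.mem_univ i)).trans ?_
  simp only [boxEnergy, Finset.mul_sum, ← Finset.sum_add_distrib]
  refine Finset.sum_le_sum fun j _ => Finset.sum_le_sum fun x _ => ?_
  have hc := edgeCnd_pos j (shift d x ω)
  simp only [Pi.zero_apply, sub_zero]
  nlinarith [mul_nonneg hc.le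
    (sq_nonneg (2 * v (shift d x ω) j - (g (x + unitv d j) - g x)))]

lemma direnergy_le {r : ℕ} {g : Vert d → ℝ} (hg : ∀ x ∉ box d (r : ℝ), g x = 0) :
    direnergy d ω (box d (r : ℝ)) v ≤ latEnergy d ω v r g := by
  refine csInf_le ⟨0, ?_⟩ ⟨g, hg, rfl⟩
  rintro _ ⟨g', -, rfl⟩
  exact latEnergy_nonneg r g'

lemma exists_near_minimizer (ω : EnvSp d) (v : EnvSp d → Fin d → ℝ) (r : ℕ) :
    ∃ g : Vert d → ℝ, (∀ x ∉ box d (r : ℝ), g x = 0) ∧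
      latEnergy d ω v r g ≤ direnergy d ω (box d (r : ℝ)) v + 1 := by
  have hne : {t | ∃ g : Vert d → ℝ, (∀ x ∉ box d (r : ℝ), g x = 0) ∧
      t = latEnergy d ω v r g}.Nonempty := ⟨_, 0, fun _ _ => rfl, rfl⟩
  obtain ⟨_, ⟨g, hg, rfl⟩, h2⟩ := Real.lt_sInf_add_pos hne one_pos
  exact ⟨g, hg, h2.le⟩

lemma Regular.tendsto_totCnd (hR : Regular d ω P) (k : ℕ) :
    Tendsto (fun r => totCnd d ω (r + k) / vol d r) atTop (𝓝 (∑ i, ∫ ω', edgeCnd d i ω' ∂P)) := by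
  have h1 : ∀ i, Tendsto (fun r : ℕ => (∑ x ∈ box d ((r + k : ℕ) : ℝ), edgeCnd d i (shift d x ω)) /
      vol d r) atTop (𝓝 (∫ ω', edgeCnd d i ω' ∂P)) := fun i => by
    simpa only [one_mul] using
      (hR.avg_mul i (fun _ => 1) continuous_const ⟨1, fun _ => by simp⟩).add k
  refine (tendsto_finsetSum Finset.univ fun i _ => h1 i).congr fun r => ?_
  rw [totCnd, Finset.sum_div]

lemma Regular.tendsto_totCnd_pred (hR : Regular d ω P) :
    Tendsto (fun r => totCnd d ω (r - 1) / vol d r) atTop (𝓝 (∑ i, ∫ ω', edgeCnd d i ω' ∂P)) := by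
  have h1 : ∀ i, Tendsto (fun r : ℕ => (∑ x ∈ box d ((r - 1 : ℕ) : ℝ), edgeCnd d i (shift d x ω)) /
      vol d r) atTop (𝓝 (∫ ω', edgeCnd d i ω' ∂P)) := fun i => by
    simpa only [one_mul] using
      (hR.avg_mul i (fun _ => 1) continuous_const ⟨1, fun _ => by simp⟩).pred
  refine (tendsto_finsetSum Finset.univ fun i _ => h1 i).congr fun r => ?_
  rw [totCnd, Finset.sum_div]

/-- Near-minimizers of the Dirichlet energy have gradients of bounded mean energy. -/
lemma Regular.exists_grad_bound (hR : Regular d ω P) {M : ℝ} (hM : ∀ ω' i, |v ω' i| ≤ M)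
    {h : ℕ → Vert d → ℝ} (hs : ∀ r : ℕ, ∀ x ∉ box d (r : ℝ), h r x = 0)
    (hmin : ∀ r : ℕ, latEnergy d ω v r (h r) ≤ direnergy d ω (box d (r : ℝ)) v + 1) :
    ∃ C, ∀ i, ∀ᶠ r : ℕ in atTop, ∑ x ∈ box d ((r + 1 : ℕ) : ℝ),
      edgeCnd d i (shift d x ω) * (h r (x + unitv d i) - h r x) ^ 2 ≤ C * vol d r := by
  refine ⟨6 * M ^ 2 * (∑ i, ∫ ω', edgeCnd d i ω' ∂P + 1) + 2, fun i => ?_⟩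
  filter_upwards [(hR.tendsto_totCnd 1).eventually (gt_mem_nhds (lt_add_one _))] with r hr
  rw [div_lt_iff₀ (vol_pos r)] at hr
  have h1 : 1 ≤ vol d r := by
    rw [vol_eq]
    exact one_le_pow₀ (by linarith [(Nat.cast_nonneg r : (0 : ℝ) ≤ r)])
  have h2 := sum_grad_sq_le (ω := ω) (v := v) r (h r) i
  have h3 := boxEnergy_le_latEnergy (ω := ω) hM (hs r)
  have h4 := hmin r
  have h5 := direnergy_le (ω := ω) (v := v) (r := r) (g := 0) fun _ _ => rfl
  have h6 := latEnergy_le_boxEnergy (ω := ω) (v := v) r 0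
  have h7 := boxEnergy_zero_le (ω := ω) hM r
  have h8 : 0 ≤ M ^ 2 * totCnd d ω r := mul_nonneg (sq_nonneg M) (totCnd_nonneg r)
  have h9 := mul_le_mul_of_nonneg_left hr.le (sq_nonneg M)
  nlinarith

end Energies

section Upper

variable {d : ℕ} {ω : EnvSp d} {P : Measure (EnvSp d)} {v : EnvSp d → Fin d → ℝ}

lemma cinnerP_self (w : EnvSp d → Fin d → ℝ) :
    cinnerP d P w w = ∑ i, ∫ ω', w ω' i ^ 2 * edgeCnd d i ω' ∂P := by
  refine Finset.sum_congr rfl fun i _ => integral_congr_ae (Eventually.of_forall fun ω' => ?_)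
  simp only [cnd_zero_unitv]
  rw [edgeCnd]
  ring

/-- Every bounded continuous potential yields an upper bound on the Dirichlet energy. -/
lemma Regular.direnergy_eventually_le (hR : Regular d ω P) (hv : Continuous v) (hvb : IsBddV d v)
    {h : EnvSp d → ℝ} (hh : Continuous h) (hhb : IsBdd d h) {ε : ℝ} (hε : 0 < ε) :
    ∀ᶠ r : ℕ in atTop, direnergy d ω (box d (r : ℝ)) v / vol d r ≤
      cinnerP d P (fun ω' i => v ω' i - gradOmega d h ω' i)
        (fun ω' i => v ω' i - gradOmega d h ω' i) + ε := by
  classical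
  obtain ⟨M, hM⟩ := hvb
  obtain ⟨K, hK0, hK⟩ := hhb.exists_pos
  set ψ : Fin d → EnvSp d → ℝ := fun i ω' => (v ω' i - gradOmega d h ω' i) ^ 2 with hψ
  have hψc : ∀ i, Continuous (ψ i) := fun i =>
    (((continuous_apply i).comp hv).sub ((hh.comp (continuous_shift _)).sub hh)).pow 2
  have hψb : ∀ i, IsBdd d (ψ i) := fun i => by
    have h1 : IsBdd d fun ω' => v ω' i - gradOmega d h ω' i :=
      IsBdd.sub ⟨M, fun ω' => hM ω' i⟩ ((hhb.comp _).sub hhb)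
    simpa only [hψ, pow_two] using h1.mul h1
  let g : ℕ → Vert d → ℝ := fun r x => if x ∈ box d (r : ℝ) then h (shift d x ω) else 0
  have hgle : ∀ r x, |g r x| ≤ K := fun r x => by
    simp only [g]
    split_ifs
    · exact hK _
    · simpa using hK0.le
  have hmain : ∀ r : ℕ, 1 ≤ r → direnergy d ω (box d (r : ℝ)) v ≤
      ∑ i, ∑ x ∈ box d ((r - 1 : ℕ) : ℝ), ψ i (shift d x ω) * edgeCnd d i (shift d x ω) +
        (M + 2 * K) ^ 2 * (totCnd d ω (r + 1) - totCnd d ω (r - 1)) := by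
    intro r hr
    refine (direnergy_le (g := g r) fun x hx => if_neg hx).trans
      ((latEnergy_le_boxEnergy r _).trans ?_)
    simp only [boxEnergy, totCnd, ← Finset.sum_sub_distrib, Finset.mul_sum,
      ← Finset.sum_add_distrib]
    refine Finset.sum_le_sum fun i _ => ?_
    have hsub : box d ((r - 1 : ℕ) : ℝ) ⊆ box d ((r + 1 : ℕ) : ℝ) := box_mono (by omega)
    rw [← Finset.sum_sdiff hsub, ← Finset.sum_sdiff (f := fun x => edgeCnd d i (shift d x ω)) hsub,
      add_sub_cancel_right, add_comm, Finset.mul_sum]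
    refine add_le_add (Finset.sum_le_sum fun x hx => ?_) (Finset.sum_le_sum fun x _ => ?_)
    · have h1 : x ∈ box d (r : ℝ) := box_mono (Nat.sub_le r 1) hx
      have h2 : x + unitv d i ∈ box d (r : ℝ) := by
        have := add_mem_box hx (unitv_mem_box i)
        rwa [Nat.sub_add_cancel hr] at this
      simp only [g, if_pos h1, if_pos h2, hψ, gradOmega, shift_shift]
      rw [add_comm x, mul_comm]
    · rw [mul_comm]
      refine mul_le_mul_of_nonneg_right (sq_le_sq' ?_ ?_) (edgeCnd_pos i _).le
      all_goals
        have h1 := abs_le.1 (hM (shift d x ω) i)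
        have h2 := abs_le.1 (hgle r x)
        have h3 := abs_le.1 (hgle r (x + unitv d i))
        linarith
  have hlim : Tendsto (fun r : ℕ => ∑ i, (∑ x ∈ box d ((r - 1 : ℕ) : ℝ),
      ψ i (shift d x ω) * edgeCnd d i (shift d x ω)) / vol d r +
        (M + 2 * K) ^ 2 * (totCnd d ω (r + 1) / vol d r - totCnd d ω (r - 1) / vol d r)) atTop
      (𝓝 (∑ i, ∫ ω', ψ i ω' * edgeCnd d i ω' ∂P + (M + 2 * K) ^ 2 * 0)) := by
    refine (tendsto_finsetSum _ fun i _ => (hR.avg_mul i _ (hψc i) (hψb i)).pred).add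
      (Tendsto.const_mul _ ?_)
    have := (hR.tendsto_totCnd 1).sub hR.tendsto_totCnd_pred
    rwa [sub_self] at this
  rw [cinnerP_self]
  filter_upwards [hlim.eventually (gt_mem_nhds (lt_add_of_pos_right _ hε)),
    eventually_ge_atTop 1] with r h1 h2
  refine (div_le_div_of_nonneg_right (hmain r h2) (vol_pos r).le).trans (le_of_eq_of_le ?_ h1.le)|>.trans
    (le_of_eq ?_)
  · rw [add_div, Finset.sum_div, mul_div_assoc, sub_div]
  · rw [mul_zero, add_zero]

end Upper

section Lower

variable {d : ℕ} {ω : EnvSp d} {P : Measure (EnvSp d)} {v : EnvSp d → Fin d → ℝ}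

/-- The homogenized energy. -/
def homEnergy (d : ℕ) (P : Measure (EnvSp d)) (v : EnvSp d → Fin d → ℝ) : ℝ :=
  sInf {t : ℝ | ∃ h : EnvSp d → ℝ, Continuous h ∧ IsBdd d h ∧
    t = cinnerP d P (fun ω' i => v ω' i - gradOmega d h ω' i)
      (fun ω' i => v ω' i - gradOmega d h ω' i)}

/-- A weighted square integral is nearly attained in its dual description by a bounded
continuous function. -/
lemma exists_dual_approx {w V X : EnvSp d → ℝ} (hw : Continuous w) (hw0 : ∀ ω', 0 < w ω')
    (hX : AEStronglyMeasurable X P) (hV : AEStronglyMeasurable V P)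
    (hwi : Integrable (fun ω' => (w ω')⁻¹) P)
    (hi : Integrable (fun ω' => w ω' * (V ω' - X ω') ^ 2) P)
    (hVi : Integrable V P) (hXi : Integrable X P) {δ : ℝ} (hδ : 0 < δ) :
    ∃ φ : EnvSp d → ℝ, Continuous φ ∧ IsBdd d φ ∧
      ∫ ω', w ω' * (V ω' - X ω') ^ 2 ∂P - δ ≤
        2 * ∫ ω', φ ω' * V ω' ∂P - ∫ ω', φ ω' ^ 2 * (w ω')⁻¹ ∂P -
          2 * ∫ ω', φ ω' * X ω' ∂P := by
  have hwm : Measurable fun ω' => (w ω')⁻¹ := hw.measurable.inv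
  have hw0' : ∀ ω', 0 ≤ (w ω')⁻¹ := fun ω' => inv_nonneg.2 (hw0 ω').le
  have := isFiniteMeasure_wMeas hwi
  have hac : wMeas P (fun ω' => (w ω')⁻¹) ≪ P := withDensity_absolutelyContinuous _ _
  have hW : MemLp (fun ω' => w ω' * (V ω' - X ω')) 2 (wMeas P fun ω' => (w ω')⁻¹) := by
    have hWm : AEStronglyMeasurable (fun ω' => w ω' * (V ω' - X ω'))
        (wMeas P fun ω' => (w ω')⁻¹) :=
      (hw.aestronglyMeasurable.mul (hV.sub hX)).mono_ac hac
    rw [memLp_two_iff_integrable_sq hWm, integrable_wMeas_iff hwm hw0']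
    refine hi.congr (Eventually.of_forall fun ω' => ?_)
    have := (hw0 ω').ne'
    simp only
    field_simp
  obtain ⟨φ, hφ, hφb, hle⟩ := exists_bdd_continuous_approx hW hδ
  refine ⟨φ, hφ, hφb, ?_⟩
  rw [integral_wMeas hwm hw0'] at hle
  have hφ2 : Integrable (fun ω' => φ ω' ^ 2 * (w ω')⁻¹) P := by
    have h2 : IsBdd d fun ω' => φ ω' ^ 2 := by simpa only [pow_two] using hφb.mul hφb
    exact h2.integrable_mul (hφ.pow 2).measurable hwi
  have hφV := (hφb.integrable_mul hφ.measurable hVi).const_mul 2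
  have hφX := (hφb.integrable_mul hφ.measurable hXi).const_mul 2
  have h1 : ∫ ω', (w ω' * (V ω' - X ω') - φ ω') ^ 2 * (w ω')⁻¹ ∂P =
      ∫ ω', w ω' * (V ω' - X ω') ^ 2 - (2 * (φ ω' * V ω') - φ ω' ^ 2 * (w ω')⁻¹ -
        2 * (φ ω' * X ω')) ∂P := by
    refine integral_congr_ae (Eventually.of_forall fun ω' => ?_)
    have := (hw0 ω').ne'
    simp only
    field_simp
    ring
  have h2 : Integrable (fun ω' => 2 * (φ ω' * V ω') - φ ω' ^ 2 * (w ω')⁻¹) P := hφV.sub hφ2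
  have h3 : Integrable (fun ω' => 2 * (φ ω' * V ω') - φ ω' ^ 2 * (w ω')⁻¹ -
    2 * (φ ω' * X ω')) P := h2.sub hφX
  rw [h1, integral_sub hi h3, integral_sub h2 hφX, integral_sub hφV hφ2, integral_const_mul, integral_const_mul] at hle
  linarith

lemma le_boxEnergy {r : ℕ} {g : Vert d → ℝ} (hg : ∀ x ∉ box d (r : ℝ), g x = 0)
    (φ : Fin d → EnvSp d → ℝ) :
    ∑ i, (2 * ∑ x ∈ box d ((r + 1 : ℕ) : ℝ), φ i (shift d x ω) * v (shift d x ω) i -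
      ∑ x ∈ box d ((r + 1 : ℕ) : ℝ), φ i (shift d x ω) ^ 2 * (edgeCnd d i (shift d x ω))⁻¹ -
      2 * incr d ω g (unitv d i) (φ i)) ≤ boxEnergy d ω v r g := by
  refine Finset.sum_le_sum fun i _ => ?_
  rw [incr_unitv_eq hg, Finset.mul_sum, Finset.mul_sum, ← Finset.sum_sub_distrib,
    ← Finset.sum_sub_distrib]
  refine Finset.sum_le_sum fun x _ => ?_
  have hc := edgeCnd_pos i (shift d x ω)
  set c := edgeCnd d i (shift d x ω)
  set a := v (shift d x ω) i - (g (x + unitv d i) - g x)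
  have h1 : 0 ≤ (c * a - φ i (shift d x ω)) ^ 2 * c⁻¹ :=
    mul_nonneg (sq_nonneg _) (inv_nonneg.2 hc.le)
  have h2 : (c * a - φ i (shift d x ω)) ^ 2 * c⁻¹ =
      c * a ^ 2 - 2 * φ i (shift d x ω) * a + φ i (shift d x ω) ^ 2 * c⁻¹ := by
    field_simp
    ring
  simp only [a] at h1 h2 ⊢
  linarith

/-- The infimum over bounded continuous potentials is dominated by the energy of `v - Φ`
for every square integrable cocycle `Φ`. -/
lemma IsCocycle.homEnergy_le (hP : StatErg d P) (hR : Regular d ω P)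
    {Φ : Vert d → EnvSp d → ℝ} (hΦ : IsCocycle d P Φ)
    (hχ : ∀ i, Integrable (fun ω' => edgeCnd d i ω' * Φ (unitv d i) ω' ^ 2) P)
    (hJ : ∀ i, Integrable (fun ω' => edgeCnd d i ω' * (v ω' i - Φ (unitv d i) ω') ^ 2) P) :
    homEnergy d P v ≤
      ∑ i, ∫ ω', edgeCnd d i ω' * (v ω' i - Φ (unitv d i) ω') ^ 2 ∂P := by
  set J := ∑ i, ∫ ω', edgeCnd d i ω' * (v ω' i - Φ (unitv d i) ω') ^ 2 ∂P
  have key : ∀ t > 0, ∀ δ > 0, homEnergy d P v ≤ (1 + t) * J + (1 + t⁻¹) * (d * δ) := by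
    intro t ht δ hδ
    obtain ⟨h, hh, hhb, hle⟩ := hΦ.exists_potential hP hR.integrable hχ hδ
    have hIle : homEnergy d P v ≤ ∑ i, ∫ ω', (v ω' i - gradOmega d h ω' i) ^ 2 * edgeCnd d i ω' ∂P := by
      rw [← cinnerP_self fun ω' i => v ω' i - gradOmega d h ω' i]
      refine csInf_le ⟨0, ?_⟩ ⟨h, hh, hhb, rfl⟩
      rintro _ ⟨h', -, -, rfl⟩
      rw [cinnerP_self]
      exact Finset.sum_nonneg fun i _ => integral_nonneg fun ω' =>
        mul_nonneg (sq_nonneg _) (edgeCnd_pos i ω').le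
    have hgc : ∀ i, Continuous fun ω' => gradOmega d h ω' i := fun i =>
      (hh.comp (continuous_shift _)).sub hh
    have hgb : ∀ i, IsBdd d fun ω' => gradOmega d h ω' i := fun i => (hhb.comp _).sub hhb
    have hgi : ∀ i, Integrable (fun ω' => gradOmega d h ω' i ^ 2 * edgeCnd d i ω') P := fun i => by
      have h2 : IsBdd d fun ω' => gradOmega d h ω' i ^ 2 := by
        simpa only [pow_two] using (hgb i).mul (hgb i)
      exact h2.integrable_mul ((hgc i).pow 2).measurable (hR.integrable i)
    have hbi : ∀ i, Integrable (fun ω' => edgeCnd d i ω' *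
        (Φ (unitv d i) ω' - (h (shift d (unitv d i) ω') - h ω')) ^ 2) P := fun i => by
      refine (((hχ i).const_mul 2).add ((hgi i).const_mul 2)).mono'
        ((continuous_edgeCnd i).aestronglyMeasurable.mul
          (((hΦ.integrable _).1.sub (hgc i).aestronglyMeasurable).pow 2))
        (Eventually.of_forall fun ω' => ?_)
      have hc := edgeCnd_pos i ω'
      rw [Real.norm_of_nonneg (mul_nonneg hc.le (sq_nonneg _))]
      simp only [Pi.add_apply, gradOmega]
      nlinarith [mul_nonneg hc.le (sq_nonneg
        (Φ (unitv d i) ω' + (h (shift d (unitv d i) ω') - h ω')))]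
    have hterm : ∀ i, ∫ ω', (v ω' i - gradOmega d h ω' i) ^ 2 * edgeCnd d i ω' ∂P ≤
        (1 + t) * ∫ ω', edgeCnd d i ω' * (v ω' i - Φ (unitv d i) ω') ^ 2 ∂P +
          (1 + t⁻¹) * δ := by
      intro i
      have ht' : 0 ≤ 1 + t⁻¹ := by positivity
      refine le_trans ?_ (add_le_add le_rfl (mul_le_mul_of_nonneg_left (hle i) ht'))
      rw [← integral_const_mul, ← integral_const_mul,
        ← integral_add ((hJ i).const_mul _) ((hbi i).const_mul _)]
      refine integral_mono_of_nonneg (Eventually.of_forall fun ω' =>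
        mul_nonneg (sq_nonneg _) (edgeCnd_pos i ω').le)
        (((hJ i).const_mul _).add ((hbi i).const_mul _)) (Eventually.of_forall fun ω' => ?_)
      have hc := edgeCnd_pos i ω'
      simp only [gradOmega]
      set a := v ω' i - Φ (unitv d i) ω' with ha
      set b := Φ (unitv d i) ω' - (h (shift d (unitv d i) ω') - h ω') with hb
      have h1 : v ω' i - (h (shift d (unitv d i) ω') - h ω') = a + b := by rw [ha, hb]; ring
      have h2 : (1 + t) * (edgeCnd d i ω' * a ^ 2) + (1 + t⁻¹) * (edgeCnd d i ω' * b ^ 2) -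
          (a + b) ^ 2 * edgeCnd d i ω' = edgeCnd d i ω' * ((t * a - b) ^ 2 * t⁻¹) := by
        field_simp
        ring
      have h3 : 0 ≤ edgeCnd d i ω' * ((t * a - b) ^ 2 * t⁻¹) := by positivity
      rw [h1]
      linarith
    refine hIle.trans ((Finset.sum_le_sum fun i _ => hterm i).trans_eq ?_)
    rw [Finset.sum_add_distrib, ← Finset.mul_sum, Finset.sum_const, Finset.card_univ,
      Fintype.card_fin, nsmul_eq_mul]
    ring
  have key2 : ∀ t > 0, homEnergy d P v ≤ (1 + t) * J := fun t ht => by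
    have h1 : Tendsto (fun δ : ℝ => (1 + t) * J + (1 + t⁻¹) * (d * δ)) (𝓝[>] 0)
        (𝓝 ((1 + t) * J + (1 + t⁻¹) * (d * 0))) :=
      (Continuous.tendsto (by fun_prop) 0).mono_left nhdsWithin_le_nhds
    have := ge_of_tendsto h1 (eventually_nhdsWithin_of_forall fun δ hδ => key t ht δ hδ)
    simpa using this
  have h1 : Tendsto (fun t : ℝ => (1 + t) * J) (𝓝[>] 0) (𝓝 ((1 + 0) * J)) :=
    (Continuous.tendsto (by fun_prop) 0).mono_left nhdsWithin_le_nhds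
  have := ge_of_tendsto h1 (eventually_nhdsWithin_of_forall key2)
  simpa using this

/-- The asymptotic lower bound, along an ultrafilter. -/
lemma eventually_le_boxEnergy (hP : StatErg d P) (hR : Regular d ω P) (hv : Continuous v)
    (hvb : IsBddV d v) {U : Ultrafilter ℕ} (hU : (U : Filter ℕ) ≤ atTop) {h : ℕ → Vert d → ℝ}
    (hs : ∀ r : ℕ, ∀ x ∉ box d (r : ℝ), h r x = 0) {C : ℝ}
    (hE : ∀ i, ∀ᶠ r : ℕ in atTop, ∑ x ∈ box d ((r + 1 : ℕ) : ℝ),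
      edgeCnd d i (shift d x ω) * (h r (x + unitv d i) - h r x) ^ 2 ≤ C * vol d r)
    {ε : ℝ} (hε : 0 < ε) :
    ∀ᶠ r : ℕ in (U : Filter ℕ),
      homEnergy d P v - ε ≤
      boxEnergy d ω v r (h r) / vol d r := by
  have := hR.prob
  obtain ⟨M, hM⟩ := hvb
  have hvc : ∀ i, Continuous fun ω' => v ω' i := fun i => (continuous_apply i).comp hv
  have hvi : ∀ i, IsBdd d fun ω' => v ω' i := fun i => ⟨M, fun ω' => hM ω' i⟩
  obtain ⟨Φ, hΦ, hrep, hχ⟩ := exists_limit_cocycle hP hR hU hs hE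
  have hJ : ∀ i, Integrable (fun ω' => edgeCnd d i ω' * (v ω' i - Φ (unitv d i) ω') ^ 2) P := by
    intro i
    have h2 : Integrable (fun ω' => v ω' i ^ 2 * edgeCnd d i ω') P := by
      have h3 : IsBdd d fun ω' => v ω' i ^ 2 := by simpa only [pow_two] using (hvi i).mul (hvi i)
      exact h3.integrable_mul ((hvc i).pow 2).measurable (hR.integrable i)
    refine ((h2.const_mul 2).add ((hχ i).const_mul 2)).mono'
      ((continuous_edgeCnd i).aestronglyMeasurable.mul
        (((hvc i).aestronglyMeasurable.sub (hΦ.integrable _).1).pow 2))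
      (Eventually.of_forall fun ω' => ?_)
    have hc := edgeCnd_pos i ω'
    rw [Real.norm_of_nonneg (mul_nonneg hc.le (sq_nonneg _))]
    simp only [Pi.add_apply]
    nlinarith [mul_nonneg hc.le (sq_nonneg (v ω' i + Φ (unitv d i) ω'))]
  have hI := hΦ.homEnergy_le hP hR hχ hJ
  set δ := ε / (2 * (d + 1)) with hδ
  have hδ0 : 0 < δ := by positivity
  choose φ hφ hφb hφle using fun i => exists_dual_approx (continuous_edgeCnd i) (edgeCnd_pos i)
    (hΦ.integrable (unitv d i)).1 (hvc i).aestronglyMeasurable (hR.integrable_inv i) (hJ i)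
    ((hvi i).memLp (hvc i).measurable 1 |>.integrable le_rfl) (hΦ.integrable (unitv d i)) hδ0
  have hlim : Tendsto (fun r : ℕ => ∑ i,
      (2 * ((∑ x ∈ box d ((r + 1 : ℕ) : ℝ), φ i (shift d x ω) * v (shift d x ω) i) / vol d r) -
        (∑ x ∈ box d ((r + 1 : ℕ) : ℝ), φ i (shift d x ω) ^ 2 *
          (edgeCnd d i (shift d x ω))⁻¹) / vol d r -
        2 * (incr d ω (h r) (unitv d i) (φ i) / vol d r))) U
      (𝓝 (∑ i, (2 * ∫ ω', φ i ω' * v ω' i ∂P - ∫ ω', φ i ω' ^ 2 * (edgeCnd d i ω')⁻¹ ∂P -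
          2 * ∫ ω', φ i ω' * Φ (unitv d i) ω' ∂P))) := by
    refine tendsto_finsetSum _ fun i _ => ((Tendsto.const_mul _ ?_).sub ?_).sub
      (((hrep _).tendsto _ (hφ i) (hφb i)).const_mul _)
    · exact ((hR.avg _ ((hφ i).mul (hvc i)) ((hφb i).mul (hvi i))).add 1).mono_left hU
    · have h2 : IsBdd d fun ω' => φ i ω' ^ 2 := by simpa only [pow_two] using (hφb i).mul (hφb i)
      exact ((hR.avg_div i _ ((hφ i).pow 2) h2).add 1).mono_left hU
  have hsum := Finset.sum_le_sum fun i (_ : i ∈ Finset.univ) => hφle i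
  rw [Finset.sum_sub_distrib, Finset.sum_const, Finset.card_univ, Fintype.card_fin,
    nsmul_eq_mul] at hsum
  have hdδ : d * δ ≤ ε / 2 := by
    rw [hδ, mul_div_assoc', div_le_div_iff₀ (by positivity) two_pos]
    nlinarith
  filter_upwards [hlim.eventually (lt_mem_nhds (sub_lt_self _ (half_pos hε)))] with r hr
  have h1 := div_le_div_of_nonneg_right (le_boxEnergy (ω := ω) (v := v) (hs r) φ) (vol_pos (d := d) r).le
  rw [Finset.sum_div] at h1
  simp only [sub_div, mul_div_assoc] at h1
  linarith

end Lower

section Main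

variable {d : ℕ} {ω : EnvSp d} {P : Measure (EnvSp d)} {v : EnvSp d → Fin d → ℝ}

lemma tendsto_inv_vol (hd : 1 ≤ d) : Tendsto (fun n => (vol d n)⁻¹) atTop (𝓝 0) := by
  refine tendsto_inv_atTop_zero.comp (tendsto_atTop_mono (fun n => ?_) tendsto_natCast_atTop_atTop)
  rw [vol_eq]
  have h0 : (0 : ℝ) ≤ n := n.cast_nonneg
  exact (by linarith : (n : ℝ) ≤ 2 * n + 1).trans (le_self_pow₀ (by linarith) (by omega))

lemma eventually_le_direnergy (hd : 1 ≤ d) (hP : StatErg d P) (hR : Regular d ω P) (hv : Continuous v)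
    (hvb : IsBddV d v) {ε : ℝ} (hε : 0 < ε) :
    ∀ᶠ r : ℕ in atTop,
      homEnergy d P v - ε ≤
      direnergy d ω (box d (r : ℝ)) v / vol d r := by
  obtain ⟨M, hM⟩ := hvb
  choose h hs hmin using exists_near_minimizer ω v
  obtain ⟨C, hC⟩ := hR.exists_grad_bound hM hs hmin
  by_contra hcon
  rw [not_eventually] at hcon
  have : NeBot (atTop ⊓ 𝓟 {r : ℕ | ¬homEnergy d P v - ε ≤
      direnergy d ω (box d (r : ℝ)) v / vol d r}) := frequently_iff_neBot.1 hcon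
  set U := Ultrafilter.of (atTop ⊓ 𝓟 {r : ℕ | ¬homEnergy d P v - ε ≤
      direnergy d ω (box d (r : ℝ)) v / vol d r}) with hUdef
  have hU : (U : Filter ℕ) ≤ atTop := (Ultrafilter.of_le _).trans inf_le_left
  have hUlt : ∀ᶠ r : ℕ in (U : Filter ℕ), ¬homEnergy d P v - ε ≤
      direnergy d ω (box d (r : ℝ)) v / vol d r :=
    le_principal_iff.1 ((Ultrafilter.of_le _).trans inf_le_right)
  have hrest : Tendsto (fun r => (vol d r)⁻¹ +
      M ^ 2 * (totCnd d ω (r + 1) / vol d r - totCnd d ω r / vol d r)) atTop (𝓝 0) := by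
    have h1 := ((hR.tendsto_totCnd 1).sub (hR.tendsto_totCnd 0)).const_mul (M ^ 2)
    rw [sub_self, mul_zero] at h1
    simpa using (tendsto_inv_vol hd).add h1
  obtain ⟨r, h1, h2, h3⟩ := ((eventually_le_boxEnergy hP hR hv ⟨M, hM⟩ hU hs hC
    (half_pos hε)).and (hUlt.and ((hrest.mono_left hU).eventually
      (gt_mem_nhds (half_pos hε))))).exists
  refine h2 ?_
  have h4 := div_le_div_of_nonneg_right
    ((boxEnergy_le_latEnergy (ω := ω) hM (hs r)).trans (add_le_add (hmin r) le_rfl))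
    (vol_pos (d := d) r).le
  rw [add_div, add_div, mul_div_assoc, sub_div, one_div] at h4
  linarith

end Main

/-- STATEMENT 15 (Proposition 5.4): homogenization of the Dirichlet energy. -/
theorem statement15 (d : ℕ) (hd : 1 ≤ d) (v : EnvSp d → Fin d → ℝ)
    (hv : Continuous v) (hvb : IsBddV d v) (p q : ℝ) (hp : 1 < p) (hq : 1 < q)
    (ω : EnvSp d) (hstar : InOmegaStar d ω) (hmom : InOmegaPQ d p q ω)
    (P : Measure (EnvSp d)) (hP : IsEnvLaw d ω P) :
    Tendsto (fun r : ℕ =>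
        direnergy d ω (box d (r : ℝ)) v / ((box d (r : ℝ)).card : ℝ)) atTop
      (𝓝 (sInf {t : ℝ | ∃ h : EnvSp d → ℝ, Continuous h ∧ IsBdd d h ∧
          t = cinnerP d P (fun ω' i => v ω' i - gradOmega d h ω' i)
                (fun ω' i => v ω' i - gradOmega d h ω' i)})) := by
  have hR := hP.regular hp hq hmom
  have hS : StatErg d P := ⟨hR.prob, hR.measurePreserving, hstar.2.2 P hP⟩
  have hne : {t : ℝ | ∃ h : EnvSp d → ℝ, Continuous h ∧ IsBdd d h ∧
      t = cinnerP d P (fun ω' i => v ω' i - gradOmega d h ω' i)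
        (fun ω' i => v ω' i - gradOmega d h ω' i)}.Nonempty :=
    ⟨_, fun _ => 0, continuous_const, ⟨0, by simp⟩, rfl⟩
  refine tendsto_order.2 ⟨fun a ha => ?_, fun a ha => ?_⟩
  · filter_upwards [eventually_le_direnergy hd hS hR hv hvb (half_pos (sub_pos.2 ha))] with r hr
    rw [homEnergy, vol] at hr
    linarith
  · obtain ⟨_, ⟨h, hh, hhb, rfl⟩, hlt⟩ := exists_lt_of_csInf_lt hne ha
    filter_upwards [hR.direnergy_eventually_le hv hvb hh hhb (half_pos (sub_pos.2 hlt))] with r hr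
    rw [vol] at hr
    linarith


end DetCond
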